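/- arXiv:2505.14110 — 2 statements merged into one kernel-verified Lean document; each statement's English description precedes it below -/
import Mathlib

section
/- Let r := √2 − 1. For every FM-tetrahedron T of type 1111 (all four radii equal to 1) and every weighted tetrahedron T₀ with all four radii equal to 1 and all six edge lengths equal to 2 (the tight tetrahedron of type 1111), one has δ(T) ≤ δ(T₀). -/
open MeasureTheory Metric

noncomputable def tetra (A B C D : EuclideanSpace ℝ (Fin 3)) :
    Set (EuclideanSpace ℝ (Fin 3)) :=
  convexHull ℝ {A, B, C, D}

noncomputable def density (A B C D : EuclideanSpace ℝ (Fin 3)) (rA rB rC rD : ℝ) : ℝ :=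
  (volume (tetra A B C D ∩
    (closedBall A rA ∪ closedBall B rB ∪ closedBall C rC ∪ closedBall D rD))).toReal /
  (volume (tetra A B C D)).toReal

local notation "E3" => EuclideanSpace ℝ (Fin 3)

noncomputable def VV (P : Fin 4 → E3) (X : Set E3) : ℝ := (volume (convexHull ℝ (Set.range P) ∩ X)).toReal

theorem null_of_dep (P : Fin 4 → E3) (h : ¬ AffineIndependent ℝ P) (X : Set E3) :
    volume (convexHull ℝ (Set.range P) ∩ X) = 0 := by
  have hne : affineSpan ℝ (Set.range P) ≠ ⊤ := by
    intro ht
    apply h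
    rw [affineIndependent_iff_finrank_vectorSpan_eq ℝ P (n := 3) (by simp)]
    rw [← direction_affineSpan, ht, AffineSubspace.direction_top, finrank_top]
    simp
  have := Measure.addHaar_affineSubspace (volume : Measure E3) _ hne
  exact measure_mono_null (Set.inter_subset_left.trans (convexHull_subset_affineSpan _)) this

theorem null_zero (g : E3 →ᵃ[ℝ] ℝ) (y : E3) (hy : g y ≠ 0) : volume {x | g x = 0} = 0 := by
  let S : AffineSubspace ℝ E3 := 
    { carrier := {x | g x = 0}
      smul_vsub_vadd_mem' := by
        intro c p1 p2 p3 h1 h2 h3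
        simp only [Set.mem_ofPred_eq] at *
        rw [AffineMap.map_vadd, LinearMap.map_smul, AffineMap.linearMap_vsub]
        simp [h1, h2, h3] }
  have : S ≠ ⊤ := by
    intro h
    have : y ∈ S := by rw [h]; trivial
    exact hy this
  exact Measure.addHaar_affineSubspace (volume : Measure E3) S this

theorem dep_update (P : Fin 4 → E3) (l : Fin 4 → ℝ) (hs : ∑ i, l i = 1) 
    (h : ¬ AffineIndependent ℝ P) (i : Fin 4) (X : Set E3) :
    volume (convexHull ℝ (Set.range (Function.update P i (∑ i, l i • P i))) ∩ X) = 0 := by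
  have hne : affineSpan ℝ (Set.range P) ≠ ⊤ := by
    intro ht
    apply h
    rw [affineIndependent_iff_finrank_vectorSpan_eq ℝ P (n := 3) (by simp)]
    rw [← direction_affineSpan, ht, AffineSubspace.direction_top, finrank_top]
    simp
  have h1 := Measure.addHaar_affineSubspace (volume : Measure E3) _ hne
  refine measure_mono_null (Set.inter_subset_left.trans ?_) h1
  apply convexHull_min _ (AffineSubspace.convex _)
  rintro _ ⟨j, rfl⟩
  by_cases hj : j = i
  · subst hj
    simp only [Function.update_self]
    have := affineCombination_mem_affineSpan hs P
    rwa [Finset.affineCombination_eq_linear_combination _ _ _ hs] at this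
  · simp only [Function.update_of_ne hj]
    exact subset_affineSpan ℝ _ ⟨j, rfl⟩

theorem split (P : Fin 4 → E3) (l : Fin 4 → ℝ) (h0 : ∀ i, 0 ≤ l i) (hs : ∑ i, l i = 1) 
    (X : Set E3) (hX : MeasurableSet X) :
    VV P X = ∑ i, VV (Function.update P i (∑ i, l i • P i)) X := by
  unfold VV
  by_cases h : AffineIndependent ℝ P
  swap
  · simp [null_of_dep P h, dep_update P l hs h]
  have htop : affineSpan ℝ (Set.range P) = ⊤ := by
    rw [h.affineSpan_eq_top_iff_card_eq_finrank_add_one]; simp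
  let b : AffineBasis (Fin 4) ℝ E3 := ⟨P, h, htop⟩
  set Q := ∑ i, l i • P i with hQ
  have hcQ : ∀ i, b.coord i Q = l i := by
    intro i
    have : Q = Finset.univ.affineCombination ℝ b l := by
      rw [Finset.affineCombination_eq_linear_combination _ _ _ hs]; rfl
    rw [this, b.coord_apply_combination_of_mem (Finset.mem_univ i) hs]
  have hcP : ∀ i j, b.coord i (P j) = if i = j then 1 else 0 := fun i j => b.coord_apply i j
  have hT : convexHull ℝ (Set.range P) = {x | ∀ i, 0 ≤ b.coord i x} := b.convexHull_eq_nonneg_coord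
  have hpiece : ∀ i k, convexHull ℝ (Set.range (Function.update P i Q)) ⊆
      {x | 0 ≤ (l i • b.coord k - l k • b.coord i) x} := by
    intro i k
    apply convexHull_min
    · rintro _ ⟨j, rfl⟩
      by_cases hj : j = i
      · subst hj
        simp [hcQ, mul_comm]
      · simp only [Function.update_of_ne hj]
        have : ¬ i = j := fun h => hj h.symm
        simp [hcP, this]
        split_ifs <;> simp [h0]
    · exact (convex_Ici (0:ℝ)).affine_preimage (l i • b.coord k - l k • b.coord i)
  have hpT : ∀ i, convexHull ℝ (Set.range (Function.update P i Q)) ⊆ convexHull ℝ (Set.range P) := by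
    intro i
    apply convexHull_min _ (convex_convexHull ℝ _)
    rintro _ ⟨j, rfl⟩
    by_cases hj : j = i
    · subst hj
      simp only [Function.update_self]
      rw [hT]; intro k; rw [hcQ]; exact h0 k
    · simp only [Function.update_of_ne hj]
      exact subset_convexHull ℝ _ ⟨j, rfl⟩
  have hcov : convexHull ℝ (Set.range P) ⊆ ⋃ i, convexHull ℝ (Set.range (Function.update P i Q)) := by
    intro x hx
    rw [hT] at hx
    obtain ⟨i, hi⟩ : ∃ i, 0 < l i ∧ ∀ k, 0 < l k → b.coord i x / l i ≤ b.coord k x / l k := by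
      have hne : (Finset.univ.filter (fun i => 0 < l i)).Nonempty := by
        by_contra hcon
        rw [Finset.not_nonempty_iff_eq_empty, Finset.filter_eq_empty_iff] at hcon
        have : ∑ i, l i ≤ 0 := Finset.sum_nonpos (fun i hi => not_lt.1 (hcon hi))
        linarith
      obtain ⟨i, hi, hm⟩ := Finset.exists_min_image _ (fun i => b.coord i x / l i) hne
      simp only [Finset.mem_filter, Finset.mem_univ, true_and] at hi hm
      exact ⟨i, hi, hm⟩
    obtain ⟨hi, hm⟩ := hi
    set t := b.coord i x / l i with ht
    have htn : 0 ≤ t := div_nonneg (hx i) hi.le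
    have hti : t * l i = b.coord i x := by rw [ht]; field_simp
    rw [Set.mem_iUnion]
    refine ⟨i, ?_⟩
    have hxe : x = ∑ j, (b.coord j x - t * l j + if j = i then t else 0) • (Function.update P i Q) j := by
      have h1 : x = ∑ j, b.coord j x • P j := (b.linear_combination_coord_eq_self x).symm
      have h2 : ∀ j, (b.coord j x - t * l j + if j = i then t else 0) • (Function.update P i Q) j
          = b.coord j x • P j - t • (l j • P j) + if j = i then t • Q else 0 := by
        intro j
        by_cases hj : j = i
        · subst hj
          simp [hti]
          rw [← hti, mul_smul, sub_self]
        · simp [hj, sub_smul, mul_smul]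
      simp_rw [h2]
      rw [Finset.sum_add_distrib, Finset.sum_sub_distrib, ← Finset.smul_sum, ← hQ, ← h1]
      simp
    rw [hxe]
    apply (convex_convexHull ℝ _).sum_mem
    · intro j _
      have : 0 ≤ b.coord j x - t * l j := by
        rcases (h0 j).lt_or_eq with hj | hj
        · have := (le_div_iff₀ hj).1 (hm j hj)
          linarith
        · rw [← hj]; simpa using hx j
      split_ifs <;> linarith
    · rw [Finset.sum_add_distrib, Finset.sum_sub_distrib, ← Finset.mul_sum, hs, b.sum_coord_apply_eq_one]
      simp
    · intro j _
      exact subset_convexHull ℝ _ ⟨j, rfl⟩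
  have hEq : convexHull ℝ (Set.range P) ∩ X = ⋃ i, (convexHull ℝ (Set.range (Function.update P i Q)) ∩ X) := by
    rw [← Set.iUnion_inter]
    congr 1
    exact hcov.antisymm (Set.iUnion_subset hpT)
  have hcpt : ∀ R : Fin 4 → E3, IsCompact (convexHull ℝ (Set.range R)) := 
    fun R => (Set.finite_range R).isCompact_convexHull ℝ
  rw [hEq, measure_iUnion₀, tsum_fintype, ENNReal.toReal_sum]
  · intro i _
    exact (measure_mono Set.inter_subset_left).trans_lt (hcpt _).measure_lt_top |>.ne
  · intro i j hij
    have hnull : ∀ i, l i = 0 → volume (convexHull ℝ (Set.range (Function.update P i Q))) = 0 := by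
      intro i hi
      refine measure_mono_null ?_ (null_zero (b.coord i) (P i) (by simp [hcP]))
      intro x hx
      obtain ⟨k, hk⟩ : ∃ k, 0 < l k := by
        by_contra! hcon
        have : ∑ i, l i ≤ 0 := Finset.sum_nonpos (fun i _ => hcon i)
        linarith
      have h1 := hpiece i k hx
      have h2 := hpT i hx
      rw [hT] at h2
      have h3 := h2 i
      simp [hi] at h1
      simp only [Set.mem_ofPred_eq]
      nlinarith
    by_cases hi : l i = 0
    · exact measure_mono_null (fun x hx => hx.1.1) (hnull i hi)
    · refine measure_mono_null ?_ (null_zero (l i • b.coord j - l j • b.coord i) (P j) (by simp [hcP, hij, hi]))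
      intro x hx
      have h1 := hpiece i j hx.1.1
      have h2 := hpiece j i hx.2.1
      simp at h1 h2 ⊢
      linarith
  · intro i
    exact ((hcpt _).isClosed.measurableSet.inter hX).nullMeasurableSet

noncomputable def WW (a b c d : E3) (X : Set E3) : ℝ :=
  (volume (convexHull ℝ {a, b, c, d} ∩ X)).toReal

theorem WW_eq (a b c d : E3) (X : Set E3) : WW a b c d X = VV ![a, b, c, d] X := by
  unfold WW VV
  congr 4
  ext x
  simp [eq_comm]
  tauto

theorem WW_split4 (A B C D O : E3) (α β γ δ : ℝ) (hα : 0 ≤ α) (hβ : 0 ≤ β) (hγ : 0 ≤ γ) (hδ : 0 ≤ δ)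
    (hs : α + β + γ + δ = 1) (hO : O = α • A + β • B + γ • C + δ • D)
    (X : Set E3) (hX : MeasurableSet X) :
    WW A B C D X = WW O B C D X + WW A O C D X + WW A B O D X + WW A B C O X := by
  have h := split ![A, B, C, D] ![α, β, γ, δ] (by intro i; fin_cases i <;> simpa)
    (by simpa [Fin.sum_univ_four] using hs) X hX
  have hO' : ∑ i, (![α, β, γ, δ] i) • (![A, B, C, D] i) = O := by
    rw [hO]; simp [Fin.sum_univ_four]
  rw [hO', Fin.sum_univ_four] at h
  have e0 : Function.update ![A, B, C, D] 0 O = ![O, B, C, D] := by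
    ext i; fin_cases i <;> simp
  have e1 : Function.update ![A, B, C, D] 1 O = ![A, O, C, D] := by
    ext i; fin_cases i <;> simp
  have e2 : Function.update ![A, B, C, D] 2 O = ![A, B, O, D] := by
    ext i; fin_cases i <;> simp [Function.update, Fin.ext_iff]
  have e3 : Function.update ![A, B, C, D] 3 O = ![A, B, C, O] := by
    ext i; fin_cases i <;> simp [Function.update, Fin.ext_iff]
  rw [e0, e1, e2, e3] at h
  simpa only [WW_eq] using h

theorem WW_null (A B C F : E3) (α β γ : ℝ) (hs : α + β + γ = 1) (hF : F = α • A + β • B + γ • C)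
    (X : Set E3) : WW A B C F X = 0 := by
  rw [WW_eq]
  unfold VV
  rw [null_of_dep, ENNReal.toReal_zero]
  rw [affineIndependent_iff_of_fintype]
  intro h
  have := h ![α, β, γ, -1] (by simp [Fin.sum_univ_four]; linarith) (by
    rw [Finset.weightedVSub_eq_linear_combination]
    · simp [Fin.sum_univ_four, hF]
      abel
    · simp [Fin.sum_univ_four]; linarith) 3
  simp at this

theorem WW_swap12 (a b c d : E3) (X : Set E3) : WW a b c d X = WW b a c d X := by
  unfold WW; rw [Set.insert_comm]
theorem WW_swap23 (a b c d : E3) (X : Set E3) : WW a b c d X = WW a c b d X := by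
  unfold WW; rw [Set.insert_comm b]
theorem WW_swap34 (a b c d : E3) (X : Set E3) : WW a b c d X = WW a b d c X := by
  unfold WW; rw [Set.pair_comm c]

theorem WW_split3 (A B C D F : E3) (α β γ : ℝ) (hα : 0 ≤ α) (hβ : 0 ≤ β) (hγ : 0 ≤ γ)
    (hs : α + β + γ = 1) (hF : F = α • A + β • B + γ • C)
    (X : Set E3) (hX : MeasurableSet X) :
    WW A B C D X = WW F B C D X + WW A F C D X + WW A B F D X := by
  rw [WW_split4 A B C D F α β γ 0 hα hβ hγ le_rfl (by linarith) (by simp [hF]) X hX,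
    WW_null A B C F α β γ hs hF, add_zero]

theorem WW_split2 (A B C D M : E3) (hM : M = (1/2 : ℝ) • A + (1/2 : ℝ) • B)
    (X : Set E3) (hX : MeasurableSet X) :
    WW A B C D X = WW M B C D X + WW A M C D X := by
  rw [WW_split3 A B C D M (1/2) (1/2) 0 (by norm_num) (by norm_num) le_rfl (by norm_num)
    (by simp [hM]) X hX, WW_swap34 A B M D, WW_null A B D M (1/2) (1/2) 0 (by norm_num) (by simp [hM]), add_zero]

/-- Gram conditions of an orthoscheme with apex `a`. -/
structure Orth (a m f o : E3) : Prop where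
  h12 : inner ℝ (m - a) (f - a) = ‖m - a‖ ^ 2
  h13 : inner ℝ (m - a) (o - a) = ‖m - a‖ ^ 2
  h23 : inner ℝ (f - a) (o - a) = ‖f - a‖ ^ 2

noncomputable def LL (p q s : E3) : E3 →ₗ[ℝ] E3 :=
  (EuclideanSpace.basisFun (Fin 3) ℝ).toBasis.constr ℝ ![p, q, s]

theorem LL_apply (p q s t : E3) : LL p q s t = t 0 • p + t 1 • q + t 2 • s := by
  unfold LL
  rw [Module.Basis.constr_apply_fintype]
  simp [Fin.sum_univ_three]

noncomputable def SS : Set E3 :=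
  convexHull ℝ {0, EuclideanSpace.single 0 1, EuclideanSpace.single 1 1, EuclideanSpace.single 2 1}

theorem SS_nonneg (t : E3) (ht : t ∈ SS) : 0 ≤ t 0 ∧ 0 ≤ t 1 ∧ 0 ≤ t 2 := by
  have : SS ⊆ {t : E3 | 0 ≤ t 0 ∧ 0 ≤ t 1 ∧ 0 ≤ t 2} := by
    apply convexHull_min
    · intro x hx
      simp only [Set.mem_insert_iff, Set.mem_singleton_iff] at hx
      rcases hx with rfl | rfl | rfl | rfl <;> simp
    · rintro x ⟨h1, h2, h3⟩ y ⟨k1, k2, k3⟩ u v hu hv huv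
      simp only [Set.mem_ofPred_eq, PiLp.add_apply, PiLp.smul_apply, smul_eq_mul]
      refine ⟨?_, ?_, ?_⟩ <;> positivity
  exact this ht

theorem WW_LL (a m f o : E3) (U : Set E3) :
    WW a m f o U = |LinearMap.det (LL (m - a) (f - a) (o - a))| *
      (volume (SS ∩ {t | a + LL (m - a) (f - a) (o - a) t ∈ U})).toReal := by
  set L := LL (m - a) (f - a) (o - a) with hL
  have h1 : convexHull ℝ {a, m, f, o} ∩ U = (fun x => a + x) '' (L '' (SS ∩ {t | a + L t ∈ U})) := by
    let g : E3 →ᵃ[ℝ] E3 := L.toAffineMap + AffineMap.const ℝ E3 a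
    have hg : ∀ t, g t = a + L t := fun t => by simp [g, add_comm]
    have h2 : convexHull ℝ {a, m, f, o} = g '' SS := by
      unfold SS
      rw [AffineMap.image_convexHull]
      congr 1
      simp only [Set.image_insert_eq, Set.image_singleton, hg, hL, LL_apply]
      simp
    rw [h2, Set.image_image, ← Set.image_inter_preimage]
    have hg' : (g : E3 → E3) = fun t => a + L t := funext hg
    rw [hg']
    rfl
  unfold WW
  rw [h1, Set.image_add_left, measure_preimage_add, Measure.addHaar_image_linearMap, ENNReal.toReal_mul,
    ENNReal.toReal_ofReal (abs_nonneg _)]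

theorem norm_expand (p q s : E3) (h12 : inner ℝ p q = ‖p‖ ^ 2) (h13 : inner ℝ p s = ‖p‖ ^ 2)
    (h23 : inner ℝ q s = ‖q‖ ^ 2) (x y z : ℝ) :
    ‖x • p + y • q + z • s‖ ^ 2 = (x ^ 2 + 2 * x * y + 2 * x * z) * ‖p‖ ^ 2 +
      (y ^ 2 + 2 * y * z) * ‖q‖ ^ 2 + z ^ 2 * ‖s‖ ^ 2 := by
  rw [norm_add_sq_real, norm_add_sq_real]
  simp only [inner_add_left, inner_smul_left, inner_smul_right, norm_smul, mul_pow, h12, h13, h23]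
  simp
  ring

theorem leaf_compare (a m f o a' m' f' o' : E3) (h : Orth a m f o) (h' : Orth a' m' f' o')
    (h1 : ‖m' - a'‖ ^ 2 ≤ ‖m - a‖ ^ 2) (h2 : ‖f' - a'‖ ^ 2 ≤ ‖f - a‖ ^ 2)
    (h3 : ‖o' - a'‖ ^ 2 ≤ ‖o - a‖ ^ 2) :
    WW a m f o (closedBall a 1) * WW a' m' f' o' Set.univ ≤
      WW a' m' f' o' (closedBall a' 1) * WW a m f o Set.univ := by
  simp only [WW_LL]
  set L := LL (m - a) (f - a) (o - a) with hL
  set L' := LL (m' - a') (f' - a') (o' - a') with hL'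
  have hfin : volume SS < ⊤ := by
    unfold SS
    exact (((Set.toFinite _).isCompact_convexHull ℝ)).measure_lt_top
  have hle : (volume (SS ∩ {t | a + L t ∈ closedBall a 1})).toReal ≤
      (volume (SS ∩ {t | a' + L' t ∈ closedBall a' 1})).toReal := by
    apply ENNReal.toReal_mono ((measure_mono Set.inter_subset_left).trans_lt hfin).ne
    apply measure_mono
    rintro t ⟨ht, hb⟩
    refine ⟨ht, ?_⟩
    obtain ⟨t0, t1, t2⟩ := SS_nonneg t ht
    simp only [Set.mem_ofPred_eq, mem_closedBall, dist_self_add_left] at hb ⊢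
    have hsq : ‖L' t‖ ^ 2 ≤ ‖L t‖ ^ 2 := by
      rw [hL, hL', LL_apply, LL_apply, norm_expand _ _ _ h.h12 h.h13 h.h23,
        norm_expand _ _ _ h'.h12 h'.h13 h'.h23]
      gcongr
    exact (abs_le_of_sq_le_sq' hsq (norm_nonneg _)).2.trans hb
  simp only [Set.mem_univ, Set.ofPred_true, Set.inter_univ]
  have e : 0 ≤ |LinearMap.det L| * |LinearMap.det L'| * (volume SS).toReal := by positivity
  nlinarith [mul_le_mul_of_nonneg_left hle e]

theorem center {n : ℕ} [NeZero n] (p : Fin n → E3) (hind : AffineIndependent ℝ p) (O : E3) (ρ : ℝ) (hρ : ρ ≤ 2)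
    (hO : ∀ i, ‖p i - O‖ ^ 2 = ρ) (hd : ∀ i j, i ≠ j → 4 ≤ ‖p i - p j‖ ^ 2) :
    ∃ l : Fin n → ℝ, (∀ i, 0 ≤ l i) ∧ ∑ i, l i = 1 ∧
      (∀ i, inner ℝ (O - ∑ j, l j • p j) (p i - ∑ j, l j • p j) = 0) ∧
      (affineSpan ℝ (Set.range p) = ⊤ → ∑ j, l j • p j = O) := by
  have hne : Nonempty (affineSpan ℝ (Set.range p)) := ⟨⟨p 0, subset_affineSpan ℝ _ ⟨0, rfl⟩⟩⟩
  obtain ⟨f, hf⟩ : ∃ f : E3, f = EuclideanGeometry.orthogonalProjection (affineSpan ℝ (Set.range p)) O := ⟨_, rfl⟩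
  have hfm : f ∈ affineSpan ℝ (Set.range p) := by
    rw [hf]; exact EuclideanGeometry.orthogonalProjection_mem _
  obtain ⟨l, hl, hfl⟩ := eq_affineCombination_of_mem_affineSpan_of_fintype hfm
  rw [Finset.affineCombination_eq_linear_combination _ _ _ hl] at hfl
  have horth : ∀ i, inner ℝ (O - f) (p i - f) = 0 := by
    intro i
    have h1 := EuclideanGeometry.vsub_orthogonalProjection_mem_direction_orthogonal (affineSpan ℝ (Set.range p)) O
    rw [← hf] at h1
    have h2 : p i -ᵥ f ∈ (affineSpan ℝ (Set.range p)).direction :=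
      AffineSubspace.vsub_mem_direction (subset_affineSpan ℝ _ ⟨i, rfl⟩) hfm
    exact Submodule.inner_left_of_mem_orthogonal h2 h1
  have hnorm : ∀ i, ‖p i - f‖ ^ 2 = ρ - ‖O - f‖ ^ 2 := by
    intro i
    rw [← hO i, show p i - O = (p i - f) - (O - f) by abel, norm_sub_sq_real (p i - f), real_inner_comm, horth]
    ring
  have hin : ∀ i j, i ≠ j → inner ℝ (p i - f) (p j - f) ≤ 0 := by
    intro i j hij
    have h1 := hd i j hij
    rw [show p i - p j = (p i - f) - (p j - f) by abel, norm_sub_sq_real, hnorm, hnorm] at h1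
    nlinarith [sq_nonneg ‖O - f‖]
  have hz : ∑ i, l i • (p i - f) = 0 := by
    simp_rw [smul_sub]
    rw [Finset.sum_sub_distrib, ← Finset.sum_smul, hl, ← hfl]
    simp
  have hexp : ∀ w : Fin n → ℝ, ‖∑ i, w i • (p i - f)‖ ^ 2 = 
      ∑ i, ∑ j, w i * w j * inner ℝ (p i - f) (p j - f) := by
    intro w
    rw [← real_inner_self_eq_norm_sq, sum_inner]
    refine Finset.sum_congr rfl fun i _ => ?_
    rw [inner_sum]
    refine Finset.sum_congr rfl fun j _ => ?_
    rw [inner_smul_left, inner_smul_right]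
    simp
    ring
  have habs : ∑ i, |l i| • (p i - f) = 0 := by
    have h1 : ‖∑ i, |l i| • (p i - f)‖ ^ 2 ≤ ‖∑ i, l i • (p i - f)‖ ^ 2 := by
      rw [hexp, hexp]
      refine Finset.sum_le_sum fun i _ => Finset.sum_le_sum fun j _ => ?_
      by_cases hij : i = j
      · subst hij; rw [abs_mul_abs_self]
      · rw [← abs_mul]
        exact mul_le_mul_of_nonpos_right (le_abs_self _) (hin i j hij)
    rw [hz, norm_zero] at h1
    have h2 : ‖∑ i, |l i| • (p i - f)‖ = 0 := by nlinarith [norm_nonneg (∑ i, |l i| • (p i - f))]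
    exact norm_eq_zero.1 h2
  set K := ∑ i, |l i| with hK
  have hK1 : 1 ≤ K := by rw [← hl]; exact Finset.sum_le_sum fun i _ => le_abs_self _
  have habs' : ∑ i, |l i| • p i = K • f := by
    simp_rw [smul_sub] at habs
    rw [Finset.sum_sub_distrib, ← Finset.sum_smul] at habs
    exact sub_eq_zero.1 habs
  have hsum0 : ∑ i, (|l i| - K * l i) = 0 := by
    rw [Finset.sum_sub_distrib, ← Finset.mul_sum, hl]; simp [hK]
  have hw := (affineIndependent_iff_of_fintype ℝ p).1 hind (fun i => |l i| - K * l i) hsum0 (by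
    rw [Finset.weightedVSub_eq_linear_combination _ hsum0]
    simp_rw [sub_smul, mul_smul]
    rw [Finset.sum_sub_distrib, ← Finset.smul_sum, ← hfl, habs', sub_self])
  refine ⟨l, ?_, hl, ?_, ?_⟩
  · intro i
    have h1 := hw i
    have := abs_nonneg (l i)
    by_contra! hneg
    nlinarith
  · rw [← hfl]; exact horth
  · intro ht
    rw [← hfl, hf, EuclideanGeometry.orthogonalProjection_eq_self_iff, ht]
    trivial

structure Face (a b c o f : E3) : Prop where
  wt : ∃ α β γ : ℝ, 0 ≤ α ∧ 0 ≤ β ∧ 0 ≤ γ ∧ α + β + γ = 1 ∧ f = α • a + β • b + γ • c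
  oa : inner ℝ (o - f) (a - f) = 0
  ob : inner ℝ (o - f) (b - f) = 0
  oc : inner ℝ (o - f) (c - f) = 0

theorem Face.swap12 {a b c o f : E3} (h : Face a b c o f) : Face b a c o f := by
  obtain ⟨⟨α, β, γ, h1, h2, h3, h4, h5⟩, ha, hb, hc⟩ := h
  exact ⟨⟨β, α, γ, h2, h1, h3, by linarith, by rw [h5]; abel⟩, hb, ha, hc⟩

theorem Face.swap23 {a b c o f : E3} (h : Face a b c o f) : Face a c b o f := by
  obtain ⟨⟨α, β, γ, h1, h2, h3, h4, h5⟩, ha, hb, hc⟩ := h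
  exact ⟨⟨α, γ, β, h1, h3, h2, by linarith, by rw [h5]; abel⟩, ha, hc, hb⟩

structure Tet (L : ℝ) (a b c d o : E3) (X : Set E3) : Prop where
  r2 : ‖a - o‖ ^ 2 ≤ 2
  rb : ‖b - o‖ ^ 2 = ‖a - o‖ ^ 2
  rc : ‖c - o‖ ^ 2 = ‖a - o‖ ^ 2
  rd : ‖d - o‖ ^ 2 = ‖a - o‖ ^ 2
  ab : 4 ≤ ‖a - b‖ ^ 2 ∧ ‖a - b‖ ^ 2 ≤ L
  ac : 4 ≤ ‖a - c‖ ^ 2 ∧ ‖a - c‖ ^ 2 ≤ L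
  ad : 4 ≤ ‖a - d‖ ^ 2 ∧ ‖a - d‖ ^ 2 ≤ L
  bc : 4 ≤ ‖b - c‖ ^ 2 ∧ ‖b - c‖ ^ 2 ≤ L
  bd : 4 ≤ ‖b - d‖ ^ 2 ∧ ‖b - d‖ ^ 2 ≤ L
  cd : 4 ≤ ‖c - d‖ ^ 2 ∧ ‖c - d‖ ^ 2 ≤ L
  wt : ∃ α β γ δ : ℝ, 0 ≤ α ∧ 0 ≤ β ∧ 0 ≤ γ ∧ 0 ≤ δ ∧ α + β + γ + δ = 1 ∧
    o = α • a + β • b + γ • c + δ • d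
  hX : ∀ x, x ∈ X ↔ dist x a ≤ 1 ∨ dist x b ≤ 1 ∨ dist x c ≤ 1 ∨ dist x d ≤ 1

theorem Tet.swap12 {L : ℝ} {a b c d o : E3} {X : Set E3} (h : Tet L a b c d o X) : Tet L b a c d o X := by
  obtain ⟨r2, rb, rc, rd, ab, ac, ad, bc, bd, cd, ⟨α, β, γ, δ, h1, h2, h3, h4, h5, h6⟩, hX⟩ := h
  exact ⟨by linarith, by linarith, by linarith, by linarith, by rwa [norm_sub_rev], bc, bd, ac, ad, cd,
    ⟨β, α, γ, δ, h2, h1, h3, h4, by linarith, by rw [h6]; abel⟩, fun x => by rw [hX]; tauto⟩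

theorem Tet.swap23 {L : ℝ} {a b c d o : E3} {X : Set E3} (h : Tet L a b c d o X) : Tet L a c b d o X := by
  obtain ⟨r2, rb, rc, rd, ab, ac, ad, bc, bd, cd, ⟨α, β, γ, δ, h1, h2, h3, h4, h5, h6⟩, hX⟩ := h
  exact ⟨r2, rc, rb, rd, ac, ab, ad, by rwa [norm_sub_rev], cd, bd,
    ⟨α, γ, β, δ, h1, h3, h2, h4, by linarith, by rw [h6]; abel⟩, fun x => by rw [hX]; tauto⟩

theorem Tet.swap34 {L : ℝ} {a b c d o : E3} {X : Set E3} (h : Tet L a b c d o X) : Tet L a b d c o X := by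
  obtain ⟨r2, rb, rc, rd, ab, ac, ad, bc, bd, cd, ⟨α, β, γ, δ, h1, h2, h3, h4, h5, h6⟩, hX⟩ := h
  exact ⟨r2, rb, rd, rc, ab, ad, ac, bd, bc, by rwa [norm_sub_rev],
    ⟨α, β, δ, γ, h1, h2, h4, h3, by linarith, by rw [h6]; abel⟩, fun x => by rw [hX]; tauto⟩

theorem face_norm {a o f : E3} (h : inner ℝ (o - f) (a - f) = 0) :
    ‖a - f‖ ^ 2 = ‖a - o‖ ^ 2 - ‖o - f‖ ^ 2 := by
  rw [show a - o = (a - f) - (o - f) by abel, norm_sub_sq_real (a - f), real_inner_comm, h]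
  ring

/-- weighted identity for the distance to a barycentre with all `‖p i - f‖² = s` -/
theorem four_id (a b c d f : E3) (α β γ δ s : ℝ) (hs : α + β + γ + δ = 1)
    (hf : f = α • a + β • b + γ • c + δ • d)
    (ha : ‖a - f‖ ^ 2 = s) (hb : ‖b - f‖ ^ 2 = s) (hc : ‖c - f‖ ^ 2 = s) (hd : δ * ‖d - f‖ ^ 2 = δ * s) :
    2 * s = β * ‖a - b‖ ^ 2 + γ * ‖a - c‖ ^ 2 + δ * ‖a - d‖ ^ 2 := by
  have h0 : α • (a - f) + β • (b - f) + γ • (c - f) + δ • (d - f) = 0 := by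
    have : α • (a - f) + β • (b - f) + γ • (c - f) + δ • (d - f) =
      (α • a + β • b + γ • c + δ • d) - (α + β + γ + δ) • f := by module
    rw [this, ← hf, hs, one_smul, sub_self]
  have h1 : inner ℝ (a - f) (α • (a - f) + β • (b - f) + γ • (c - f) + δ • (d - f)) = 0 := by
    rw [h0, inner_zero_right]
  simp only [inner_add_right, inner_smul_right, real_inner_self_eq_norm_sq] at h1
  rw [show a - b = (a - f) - (b - f) by abel, show a - c = (a - f) - (c - f) by abel,
    show a - d = (a - f) - (d - f) by abel, norm_sub_sq_real, norm_sub_sq_real (a - f),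
    norm_sub_sq_real (a - f), hb, hc]
  rw [ha] at *
  linear_combination 2 * h1 - hd - 2 * s * hs

theorem leaf_len {L : ℝ} {a b c d o m f : E3} {X : Set E3} (h : Tet L a b c d o X) (hF : Face a b c o f)
    (hm : m = (1/2 : ℝ) • a + (1/2 : ℝ) • b) :
    (1 ≤ ‖m - a‖ ^ 2 ∧ ‖m - a‖ ^ 2 ≤ L / 4) ∧ (4/3 ≤ ‖f - a‖ ^ 2 ∧ ‖f - a‖ ^ 2 ≤ L / 3) ∧
      (3/2 ≤ ‖o - a‖ ^ 2 ∧ ‖o - a‖ ^ 2 ≤ 3 * L / 8) := by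
  have key : ∀ x y l : ℝ, 0 ≤ l → 4 ≤ x ∧ x ≤ L → 4 * l ≤ l * x ∧ l * x ≤ L * l := by
    rintro x y l hl ⟨h1, h2⟩
    constructor <;> nlinarith
  refine ⟨?_, ?_, ?_⟩
  · have : m - a = (-(1/2) : ℝ) • (a - b) := by rw [hm]; module
    rw [this, norm_smul, mul_pow]
    have := h.ab
    norm_num
    constructor <;> linarith
  · obtain ⟨α, β, γ, hα, hβ, hγ, hs, hf⟩ := hF.wt
    have ea := face_norm hF.oa
    have eb := face_norm hF.ob
    have ec := face_norm hF.oc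
    rw [h.rb, ← ea] at eb
    rw [h.rc, ← ea] at ec
    rw [norm_sub_rev f a]
    set s := ‖a - f‖ ^ 2 with hs'
    have i1 := four_id a b c 0 f α β γ 0 s (by linarith) (by rw [hf]; simp) rfl eb ec (by simp)
    have i2 := four_id b a c 0 f β α γ 0 s (by linarith) (by rw [hf]; module) eb rfl ec (by simp)
    have i3 := four_id c b a 0 f γ β α 0 s (by linarith) (by rw [hf]; module) ec eb rfl (by simp)
    rw [norm_sub_rev b a] at i2
    rw [norm_sub_rev c a, norm_sub_rev c b] at i3
    have k1 := key _ 0 α hα h.ab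
    have k2 := key _ 0 α hα h.ac
    have k3 := key _ 0 β hβ h.ab
    have k4 := key _ 0 β hβ h.bc
    have k5 := key _ 0 γ hγ h.ac
    have k6 := key _ 0 γ hγ h.bc
    have hL : L * α + L * β + L * γ = L := by rw [← mul_add, ← mul_add, hs, mul_one]
    constructor <;> linarith [k1.1, k1.2, k2.1, k2.2, k3.1, k3.2, k4.1, k4.2, k5.1, k5.2, k6.1, k6.2]
  · obtain ⟨α, β, γ, δ, hα, hβ, hγ, hδ, hs, hf⟩ := h.wt
    have eb := h.rb
    have ec := h.rc
    have ed := h.rd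
    rw [norm_sub_rev o a]
    set s := ‖a - o‖ ^ 2 with hs'
    have i1 := four_id a b c d o α β γ δ s (by linarith) hf rfl eb ec (by rw [ed])
    have i2 := four_id b a c d o β α γ δ s (by linarith) (by rw [hf]; module) eb rfl ec (by rw [ed])
    have i3 := four_id c b a d o γ β α δ s (by linarith) (by rw [hf]; module) ec eb rfl (by rw [ed])
    have i4 := four_id d b c a o δ β γ α s (by linarith) (by rw [hf]; module) ed eb ec rfl
    rw [norm_sub_rev b a] at i2
    rw [norm_sub_rev c a, norm_sub_rev c b] at i3
    rw [norm_sub_rev d a, norm_sub_rev d b, norm_sub_rev d c] at i4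
    have k1 := key _ 0 α hα h.ab
    have k2 := key _ 0 α hα h.ac
    have k3 := key _ 0 α hα h.ad
    have k4 := key _ 0 β hβ h.ab
    have k5 := key _ 0 β hβ h.bc
    have k6 := key _ 0 β hβ h.bd
    have k7 := key _ 0 γ hγ h.ac
    have k8 := key _ 0 γ hγ h.bc
    have k9 := key _ 0 γ hγ h.cd
    have k10 := key _ 0 δ hδ h.ad
    have k11 := key _ 0 δ hδ h.bd
    have k12 := key _ 0 δ hδ h.cd
    have hL : L * α + L * β + L * γ + L * δ = L := by rw [← mul_add, ← mul_add, ← mul_add, hs, mul_one]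
    constructor
    · linarith [k1.1, k2.1, k3.1, k4.1, k5.1, k6.1, k7.1, k8.1, k9.1, k10.1, k11.1, k12.1]
    · linarith [k1.2, k2.2, k3.2, k4.2, k5.2, k6.2, k7.2, k8.2, k9.2, k10.2, k11.2, k12.2]

theorem leaf_orth {L : ℝ} {a b c d o m f : E3} {X : Set E3} (h : Tet L a b c d o X) (hF : Face a b c o f)
    (hm : m = (1/2 : ℝ) • a + (1/2 : ℝ) • b) : Orth a m f o := by
  have hma : m - a = (1/2 : ℝ) • (b - a) := by rw [hm]; module
  have key : ∀ x : E3, ‖b - x‖ ^ 2 = ‖a - x‖ ^ 2 → inner ℝ (m - a) (x - a) = ‖m - a‖ ^ 2 := by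
    intro x hx
    rw [hma, inner_smul_left, norm_smul, mul_pow]
    rw [show b - x = (b - a) - (x - a) by abel, norm_sub_sq_real, norm_sub_rev a x] at hx
    norm_num
    linarith
  have ea := face_norm hF.oa
  have eb := face_norm hF.ob
  rw [h.rb, ← ea] at eb
  refine ⟨key f eb, key o h.rb, ?_⟩
  rw [show o - a = (o - f) + (f - a) by abel, inner_add_right, real_inner_self_eq_norm_sq,
    show f - a = -(a - f) by abel, inner_neg_left, real_inner_comm, hF.oa]
  simp

theorem leaf_near {L : ℝ} {a b c d o m f : E3} {X : Set E3} (h : Tet L a b c d o X) (hF : Face a b c o f)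
    (hm : m = (1/2 : ℝ) • a + (1/2 : ℝ) • b) : WW a m f o X = WW a m f o (closedBall a 1) := by
  have ea := face_norm hF.oa
  have eb := face_norm hF.ob
  have ec := face_norm hF.oc
  rw [h.rb] at eb
  rw [h.rc] at ec
  have neg : ∀ x y : E3, ‖x - o‖ ^ 2 = ‖a - o‖ ^ 2 → ‖y - o‖ ^ 2 = ‖a - o‖ ^ 2 → 4 ≤ ‖x - y‖ ^ 2 →
      inner ℝ (x - o) (y - o) ≤ 0 := by
    intro x y hx hy hxy
    rw [show x - y = (x - o) - (y - o) by abel, norm_sub_sq_real, hx, hy] at hxy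
    linarith [h.r2]
  -- distance from a point with nonpositive inner product
  have far : ∀ w z : E3, ‖w - o‖ ^ 2 = ‖a - o‖ ^ 2 → inner ℝ (w - o) (z - o) ≤ 0 →
      ‖a - o‖ ^ 2 ≤ ‖z - w‖ ^ 2 := by
    intro w z hw hi
    rw [norm_sub_rev z w, show w - z = (w - o) - (z - o) by abel, norm_sub_sq_real (w - o), hw]
    nlinarith [sq_nonneg ‖z - o‖]
  have mb : ‖m - b‖ ^ 2 = ‖m - a‖ ^ 2 := by
    rw [show m - b = -(m - a) by rw [hm]; module, norm_neg]
  have mle : ‖m - a‖ ^ 2 ≤ ‖a - o‖ ^ 2 := by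
    rw [show m - a = (-(1/2) : ℝ) • ((a - o) - (b - o)) by rw [hm]; module, norm_smul, mul_pow]
    have h1 := parallelogram_law_with_norm ℝ (a - o) (b - o)
    have h2 := h.rb
    rw [sub_sub_sub_cancel_right] at h1
    norm_num
    nlinarith [sq_nonneg ‖a - o + (b - o)‖]
  have mfar : ∀ w, ‖w - o‖ ^ 2 = ‖a - o‖ ^ 2 → 4 ≤ ‖a - w‖ ^ 2 → 4 ≤ ‖b - w‖ ^ 2 →
      ‖m - a‖ ^ 2 ≤ ‖m - w‖ ^ 2 := by
    intro w hw h1 h2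
    refine mle.trans (far w m hw ?_)
    rw [show m - o = (1/2 : ℝ) • (a - o) + (1/2 : ℝ) • (b - o) by rw [hm]; module, inner_add_right,
      inner_smul_right, inner_smul_right]
    have k1 := neg w a hw rfl (by rwa [norm_sub_rev])
    have k2 := neg w b hw h.rb (by rwa [norm_sub_rev])
    linarith
  have ffar : ‖f - a‖ ^ 2 ≤ ‖f - d‖ ^ 2 := by
    obtain ⟨α, β, γ, hα, hβ, hγ, hs, hf⟩ := hF.wt
    have : ‖f - a‖ ^ 2 ≤ ‖a - o‖ ^ 2 := by
      rw [norm_sub_rev]; nlinarith [sq_nonneg ‖o - f‖]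
    refine this.trans (far d f h.rd ?_)
    have e : f - o = α • (a - o) + β • (b - o) + γ • (c - o) := by
      rw [hf]
      have : o = (α + β + γ) • o := by rw [hs, one_smul]
      nth_rewrite 1 [this]
      module
    rw [e, inner_add_right, inner_add_right, inner_smul_right, inner_smul_right, inner_smul_right]
    have k1 := neg d a h.rd rfl (by rw [norm_sub_rev]; exact h.ad.1)
    have k2 := neg d b h.rd h.rb (by rw [norm_sub_rev]; exact h.bd.1)
    have k3 := neg d c h.rd h.rc (by rw [norm_sub_rev]; exact h.cd.1)
    nlinarith [mul_nonneg hα (neg_nonneg.2 k1), mul_nonneg hβ (neg_nonneg.2 k2), mul_nonneg hγ (neg_nonneg.2 k3)]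
  have hall : ∀ w, ‖m - a‖ ^ 2 ≤ ‖m - w‖ ^ 2 → ‖f - a‖ ^ 2 ≤ ‖f - w‖ ^ 2 → ‖w - o‖ ^ 2 = ‖a - o‖ ^ 2 →
      ∀ x ∈ convexHull ℝ {a, m, f, o}, dist x a ≤ dist x w := by
    intro w hmw hfw how
    have hcv : ∀ x : E3, dist x a ≤ dist x w ↔ inner ℝ (x - a) (w - a) ≤ ‖w - a‖ ^ 2 / 2 := by
      intro x
      rw [dist_eq_norm, dist_eq_norm, ← sq_le_sq₀ (norm_nonneg _) (norm_nonneg _),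
        show x - w = (x - a) - (w - a) by abel, norm_sub_sq_real (x - a)]
      constructor <;> intro h <;> linarith
    have hsub : convexHull ℝ {a, m, f, o} ⊆ {x | inner ℝ (x - a) (w - a) ≤ ‖w - a‖ ^ 2 / 2} := by
      apply convexHull_min
      · intro x hx
        simp only [Set.mem_insert_iff, Set.mem_singleton_iff] at hx
        simp only [Set.mem_ofPred_eq, ← hcv]
        rw [dist_eq_norm, dist_eq_norm, ← sq_le_sq₀ (norm_nonneg _) (norm_nonneg _)]
        rcases hx with rfl | rfl | rfl | rfl
        · simp
        · exact hmw
        · exact hfw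
        · rw [norm_sub_rev, norm_sub_rev x w, how]
      · intro x hx y hy u v hu hv huv
        simp only [Set.mem_ofPred_eq] at *
        have : u • x + v • y - a = u • (x - a) + v • (y - a) := by
          have : a = (u + v) • a := by rw [huv, one_smul]
          nth_rewrite 1 [this]
          module
        rw [this, inner_add_left, inner_smul_left, inner_smul_left]
        simp only [conj_trivial]
        have : ‖w - a‖ ^ 2 / 2 = u * (‖w - a‖ ^ 2 / 2) + v * (‖w - a‖ ^ 2 / 2) := by
          rw [← add_mul, huv, one_mul]
        rw [this]
        gcongr
    intro x hx
    rw [hcv]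
    exact hsub hx
  have H1 := hall b mb.ge (by rw [norm_sub_rev, norm_sub_rev f b, ea, eb]) h.rb
  have H2 := hall c (mfar c h.rc h.ac.1 h.bc.1) (by rw [norm_sub_rev, norm_sub_rev f c, ea, ec]) h.rc
  have H3 := hall d (mfar d h.rd h.ad.1 h.bd.1) ffar h.rd
  unfold WW
  congr 2
  ext x
  simp only [Set.mem_inter_iff, mem_closedBall, h.hX]
  constructor
  · rintro ⟨hx, hh⟩
    refine ⟨hx, ?_⟩
    rcases hh with hh | hh | hh | hh
    · exact hh
    · exact (H1 x hx).trans hh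
    · exact (H2 x hx).trans hh
    · exact (H3 x hx).trans hh
  · rintro ⟨hx, hh⟩
    exact ⟨hx, Or.inl hh⟩

noncomputable def Phi (p q : ℝ) (X : Set E3) (a b c d : E3) : ℝ := p * WW a b c d X + q * WW a b c d Set.univ

theorem Phi_leafs {L p q : ℝ} {X : Set E3} (hXm : MeasurableSet X) {O : E3}
    (h : ∀ a b c d m f, Tet L a b c d O X → Face a b c O f → m = (1/2 : ℝ) • a + (1/2 : ℝ) • b →
      Phi p q X a m f O ≤ 0)
    {A B C D : E3} (hT : Tet L A B C D O X) {F : E3} (hF : Face A B C O F) : Phi p q X A B F O ≤ 0 := by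
  have e1 := h A B C D _ F hT hF rfl
  have e2 := h B A C D _ F hT.swap12 hF.swap12 rfl
  rw [add_comm] at e2
  unfold Phi at *
  have s1 := WW_split2 A B F O _ rfl X hXm
  have s2 := WW_split2 A B F O _ rfl Set.univ MeasurableSet.univ
  rw [WW_swap12 ((1/2 : ℝ) • A + (1/2 : ℝ) • B) B] at s1 s2
  rw [s1, s2]
  linarith

theorem Phi_face {L p q : ℝ} {X : Set E3} (hXm : MeasurableSet X) {O : E3}
    (h : ∀ a b c d m f, Tet L a b c d O X → Face a b c O f → m = (1/2 : ℝ) • a + (1/2 : ℝ) • b →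
      Phi p q X a m f O ≤ 0)
    {A B C D : E3} (hT : Tet L A B C D O X) (hF : ∃ F, Face A B C O F) : Phi p q X A B C O ≤ 0 := by
  obtain ⟨F, hF⟩ := hF
  obtain ⟨α, β, γ, hα, hβ, hγ, hs, hf⟩ := hF.wt
  have e1 := Phi_leafs hXm h hT hF
  have e2 := Phi_leafs hXm h hT.swap23 hF.swap23
  have e3 := Phi_leafs hXm h hT.swap12.swap23 hF.swap12.swap23
  unfold Phi at *
  have s1 := WW_split3 A B C O F α β γ hα hβ hγ hs hf X hXm
  have s2 := WW_split3 A B C O F α β γ hα hβ hγ hs hf Set.univ MeasurableSet.univ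
  rw [WW_swap12 F B, WW_swap23 B F, WW_swap23 A F] at s1 s2
  rw [s1, s2]
  linarith

theorem Phi_tet {L p q : ℝ} {X : Set E3} (hXm : MeasurableSet X) {O : E3}
    (h : ∀ a b c d m f, Tet L a b c d O X → Face a b c O f → m = (1/2 : ℝ) • a + (1/2 : ℝ) • b →
      Phi p q X a m f O ≤ 0)
    {A B C D : E3} (hT : Tet L A B C D O X) (h1 : ∃ F, Face A B C O F) (h2 : ∃ F, Face A B D O F)
    (h3 : ∃ F, Face A C D O F) (h4 : ∃ F, Face B C D O F) : Phi p q X A B C D ≤ 0 := by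
  obtain ⟨α, β, γ, δ, hα, hβ, hγ, hδ, hs, hf⟩ := hT.wt
  have e1 := Phi_face hXm h hT h1
  have e2 := Phi_face hXm h hT.swap34 h2
  have e3 := Phi_face hXm h hT.swap23.swap34 h3
  have e4 := Phi_face hXm h hT.swap12.swap23.swap34 h4
  unfold Phi at *
  have s1 := WW_split4 A B C D O α β γ δ hα hβ hγ hδ hs hf X hXm
  have s2 := WW_split4 A B C D O α β γ δ hα hβ hγ hδ hs hf Set.univ MeasurableSet.univ
  rw [WW_swap12 O B, WW_swap23 B O, WW_swap34 B C, WW_swap23 A O, WW_swap34 A C O, WW_swap34 A B O] at s1 s2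
  rw [s1, s2]
  linarith

theorem face_exists {A B C O : E3} {ρ : ℝ} (hind : AffineIndependent ℝ ![A, B, C]) (hρ : ρ ≤ 2)
    (hA : ‖A - O‖ ^ 2 = ρ) (hB : ‖B - O‖ ^ 2 = ρ) (hC : ‖C - O‖ ^ 2 = ρ)
    (hAB : 4 ≤ ‖A - B‖ ^ 2) (hAC : 4 ≤ ‖A - C‖ ^ 2) (hBC : 4 ≤ ‖B - C‖ ^ 2) : ∃ F, Face A B C O F := by
  obtain ⟨l, h0, hs, ho, -⟩ := center ![A, B, C] hind O ρ hρ
    (by intro i; fin_cases i <;> simpa)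
    (by
      intro i j hij
      fin_cases i <;> fin_cases j <;> simp at hij ⊢ <;> first | assumption | (rw [norm_sub_rev]; assumption))
  exact ⟨_, ⟨l 0, l 1, l 2, h0 0, h0 1, h0 2, by rw [← hs, Fin.sum_univ_three], by
    rw [Fin.sum_univ_three]; rfl⟩, ho 0, ho 1, ho 2⟩

def XX (A B C D : E3) : Set E3 := closedBall A 1 ∪ closedBall B 1 ∪ closedBall C 1 ∪ closedBall D 1

theorem tet_exists {L : ℝ} {A B C D O : E3} {ρ : ℝ} (hind : AffineIndependent ℝ ![A, B, C, D]) (hρ : ρ ≤ 2)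
    (hA : ‖A - O‖ ^ 2 = ρ) (hB : ‖B - O‖ ^ 2 = ρ) (hC : ‖C - O‖ ^ 2 = ρ) (hD : ‖D - O‖ ^ 2 = ρ)
    (hAB : 4 ≤ ‖A - B‖ ^ 2 ∧ ‖A - B‖ ^ 2 ≤ L) (hAC : 4 ≤ ‖A - C‖ ^ 2 ∧ ‖A - C‖ ^ 2 ≤ L)
    (hAD : 4 ≤ ‖A - D‖ ^ 2 ∧ ‖A - D‖ ^ 2 ≤ L) (hBC : 4 ≤ ‖B - C‖ ^ 2 ∧ ‖B - C‖ ^ 2 ≤ L)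
    (hBD : 4 ≤ ‖B - D‖ ^ 2 ∧ ‖B - D‖ ^ 2 ≤ L) (hCD : 4 ≤ ‖C - D‖ ^ 2 ∧ ‖C - D‖ ^ 2 ≤ L) :
    Tet L A B C D O (XX A B C D) ∧ (∃ F, Face A B C O F) ∧ (∃ F, Face A B D O F) ∧
      (∃ F, Face A C D O F) ∧ (∃ F, Face B C D O F) := by
  have i1 : AffineIndependent ℝ ![A, B, C] := by
    convert hind.comp_embedding ⟨![0, 1, 2], by decide⟩ using 1
    ext i; fin_cases i <;> rfl
  have i2 : AffineIndependent ℝ ![A, B, D] := by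
    convert hind.comp_embedding ⟨![0, 1, 3], by decide⟩ using 1
    ext i; fin_cases i <;> rfl
  have i3 : AffineIndependent ℝ ![A, C, D] := by
    convert hind.comp_embedding ⟨![0, 2, 3], by decide⟩ using 1
    ext i; fin_cases i <;> rfl
  have i4 : AffineIndependent ℝ ![B, C, D] := by
    convert hind.comp_embedding ⟨![1, 2, 3], by decide⟩ using 1
    ext i; fin_cases i <;> rfl
  refine ⟨?_, face_exists i1 hρ hA hB hC hAB.1 hAC.1 hBC.1, face_exists i2 hρ hA hB hD hAB.1 hAD.1 hBD.1,
    face_exists i3 hρ hA hC hD hAC.1 hAD.1 hCD.1, face_exists i4 hρ hB hC hD hBC.1 hBD.1 hCD.1⟩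
  refine ⟨hA ▸ hρ, hB.trans hA.symm, hC.trans hA.symm, hD.trans hA.symm, hAB, hAC, hAD, hBC, hBD, hCD, ?_, ?_⟩
  · obtain ⟨hAB, -⟩ := hAB
    obtain ⟨hAC, -⟩ := hAC
    obtain ⟨hAD, -⟩ := hAD
    obtain ⟨hBC, -⟩ := hBC
    obtain ⟨hBD, -⟩ := hBD
    obtain ⟨hCD, -⟩ := hCD
    obtain ⟨l, h0, hs, -, ho⟩ := center ![A, B, C, D] hind O ρ hρ
      (by intro i; fin_cases i <;> simpa)
      (by
        intro i j hij
        fin_cases i <;> fin_cases j <;> simp at hij ⊢ <;> first | assumption | (rw [norm_sub_rev]; assumption))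
    have htop : affineSpan ℝ (Set.range ![A, B, C, D]) = ⊤ := by
      rw [hind.affineSpan_eq_top_iff_card_eq_finrank_add_one]; simp
    refine ⟨l 0, l 1, l 2, l 3, h0 0, h0 1, h0 2, h0 3, by rw [← hs, Fin.sum_univ_four], ?_⟩
    rw [← ho htop, Fin.sum_univ_four]; rfl
  · intro x
    simp only [XX, Set.mem_union, mem_closedBall]
    tauto

theorem XX_meas (A B C D : E3) : MeasurableSet (XX A B C D) :=
  ((measurableSet_closedBall.union measurableSet_closedBall).union measurableSet_closedBall).union
    measurableSet_closedBall

/-- A regular tetrahedron of edge 2: its barycentre is at squared distance 3/2 from the vertices. -/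
theorem reg_center {A B C D : E3} (hAB : ‖A - B‖ ^ 2 = 4) (hAC : ‖A - C‖ ^ 2 = 4) (hAD : ‖A - D‖ ^ 2 = 4)
    (hBC : ‖B - C‖ ^ 2 = 4) (hBD : ‖B - D‖ ^ 2 = 4) (hCD : ‖C - D‖ ^ 2 = 4) :
    ‖A - (1/4 : ℝ) • (A + B + C + D)‖ ^ 2 = 3/2 := by
  have : A - (1/4 : ℝ) • (A + B + C + D) = (1/4 : ℝ) • ((A - B) + (A - C) + (A - D)) := by module
  rw [this, norm_smul, mul_pow, norm_add_sq_real, norm_add_sq_real, inner_add_left]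
  rw [show B - C = (A - C) - (A - B) by abel, norm_sub_sq_real (A - C)] at hBC
  rw [show B - D = (A - D) - (A - B) by abel, norm_sub_sq_real (A - D)] at hBD
  rw [show C - D = (A - D) - (A - C) by abel, norm_sub_sq_real (A - D)] at hCD
  rw [real_inner_comm] at hBC hBD hCD
  norm_num
  linarith

/-- The densest FM-tetrahedron of type 1111 is the tight one (all edges of length 2). -/
theorem densest_1111
    (A B C D A₀ B₀ C₀ D₀ : EuclideanSpace ℝ (Fin 3))
    (haff : AffineIndependent ℝ ![A, B, C, D])
    (hAB : 2 ≤ dist A B) (hAC : 2 ≤ dist A C) (hAD : 2 ≤ dist A D)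
    (hBC : 2 ≤ dist B C) (hBD : 2 ≤ dist B D) (hCD : 2 ≤ dist C D)
    (hsupp : ∃ O : EuclideanSpace ℝ (Fin 3), ∃ R : ℝ, 0 < R ∧ R ≤ Real.sqrt 2 - 1 ∧
      dist O A = 1 + R ∧ dist O B = 1 + R ∧ dist O C = 1 + R ∧ dist O D = 1 + R)
    (haff₀ : AffineIndependent ℝ ![A₀, B₀, C₀, D₀])
    (hAB₀ : dist A₀ B₀ = 2) (hAC₀ : dist A₀ C₀ = 2) (hAD₀ : dist A₀ D₀ = 2)
    (hBC₀ : dist B₀ C₀ = 2) (hBD₀ : dist B₀ D₀ = 2) (hCD₀ : dist C₀ D₀ = 2) :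
    density A B C D 1 1 1 1 ≤ density A₀ B₀ C₀ D₀ 1 1 1 1 := by
  obtain ⟨O, R, hR0, hR, oA, oB, oC, oD⟩ := hsupp
  have hρ : (1 + R) ^ 2 ≤ 2 := by
    have : (1 + R) ^ 2 ≤ (Real.sqrt 2) ^ 2 := by
      apply pow_le_pow_left₀ <;> linarith
    rwa [Real.sq_sqrt (by norm_num)] at this
  have sqO : ∀ V : E3, dist O V = 1 + R → ‖V - O‖ ^ 2 = (1 + R) ^ 2 := by
    intro V h
    rw [← h, dist_comm, dist_eq_norm]
  have sq4 : ∀ V W : E3, 2 ≤ dist V W → dist O V = 1 + R → dist O W = 1 + R →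
      4 ≤ ‖V - W‖ ^ 2 ∧ ‖V - W‖ ^ 2 ≤ 8 := by
    intro V W h hV hW
    have h1 := dist_triangle_left V W O
    rw [← dist_eq_norm]
    constructor
    · nlinarith
    · rw [hV, hW] at h1
      nlinarith [dist_nonneg (x := V) (y := W)]
  obtain ⟨T, f1, f2, f3, f4⟩ := tet_exists haff hρ (sqO A oA) (sqO B oB) (sqO C oC) (sqO D oD)
    (sq4 _ _ hAB oA oB) (sq4 _ _ hAC oA oC) (sq4 _ _ hAD oA oD) (sq4 _ _ hBC oB oC) (sq4 _ _ hBD oB oD)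
    (sq4 _ _ hCD oC oD)
  have eq4 : ∀ V W : E3, dist V W = 2 → ‖V - W‖ ^ 2 = 4 := by
    intro V W h
    rw [← dist_eq_norm, h]; norm_num
  have eq4' : ∀ V W : E3, dist V W = 2 → 4 ≤ ‖V - W‖ ^ 2 ∧ ‖V - W‖ ^ 2 ≤ 4 := 
    fun V W h => ⟨(eq4 V W h).ge, (eq4 V W h).le⟩
  have eq4s : ∀ V W : E3, dist V W = 2 → ‖W - V‖ ^ 2 = 4 := 
    fun V W h => by rw [norm_sub_rev]; exact eq4 V W h
  obtain ⟨O₀, hO₀⟩ : ∃ O₀, O₀ = (1/4 : ℝ) • (A₀ + B₀ + C₀ + D₀) := ⟨_, rfl⟩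
  have rA : ‖A₀ - O₀‖ ^ 2 = 3/2 := by
    rw [hO₀]
    exact reg_center (eq4 _ _ hAB₀) (eq4 _ _ hAC₀) (eq4 _ _ hAD₀) (eq4 _ _ hBC₀) (eq4 _ _ hBD₀) (eq4 _ _ hCD₀)
  have rB : ‖B₀ - O₀‖ ^ 2 = 3/2 := by
    rw [hO₀, add_comm A₀ B₀]
    exact reg_center (eq4s _ _ hAB₀) (eq4 _ _ hBC₀) (eq4 _ _ hBD₀) (eq4 _ _ hAC₀) (eq4 _ _ hAD₀) (eq4 _ _ hCD₀)
  have rC : ‖C₀ - O₀‖ ^ 2 = 3/2 := by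
    rw [hO₀, show A₀ + B₀ + C₀ + D₀ = C₀ + A₀ + B₀ + D₀ by abel]
    exact reg_center (eq4s _ _ hAC₀) (eq4s _ _ hBC₀) (eq4 _ _ hCD₀) (eq4 _ _ hAB₀) (eq4 _ _ hAD₀) (eq4 _ _ hBD₀)
  have rD : ‖D₀ - O₀‖ ^ 2 = 3/2 := by
    rw [hO₀, show A₀ + B₀ + C₀ + D₀ = D₀ + A₀ + B₀ + C₀ by abel]
    exact reg_center (eq4s _ _ hAD₀) (eq4s _ _ hBD₀) (eq4s _ _ hCD₀) (eq4 _ _ hAB₀) (eq4 _ _ hAC₀) (eq4 _ _ hBC₀)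
  obtain ⟨T₀, g1, g2, g3, g4⟩ := tet_exists haff₀ (by norm_num) rA rB rC rD
    (eq4' _ _ hAB₀) (eq4' _ _ hAC₀) (eq4' _ _ hAD₀) (eq4' _ _ hBC₀) (eq4' _ _ hBD₀) (eq4' _ _ hCD₀)
  set X := XX A B C D with hX
  set X₀ := XX A₀ B₀ C₀ D₀ with hX₀
  have hXm : MeasurableSet X := XX_meas A B C D
  have hXm₀ : MeasurableSet X₀ := XX_meas A₀ B₀ C₀ D₀
  have main : Phi (-WW A B C D Set.univ) (WW A B C D X) X₀ A₀ B₀ C₀ D₀ ≤ 0 := by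
    refine Phi_tet hXm₀ ?_ T₀ g1 g2 g3 g4
    intro a' b' c' d' m' f' hT' hF' hm'
    have inner_main : Phi (WW a' m' f' O₀ Set.univ) (-WW a' m' f' O₀ X₀) X A B C D ≤ 0 := by
      refine Phi_tet hXm ?_ T f1 f2 f3 f4
      intro a b c d m f hT hF hm
      unfold Phi
      rw [leaf_near hT hF hm, leaf_near hT' hF' hm']
      obtain ⟨l1, l2, l3⟩ := leaf_len hT hF hm
      obtain ⟨k1, k2, k3⟩ := leaf_len hT' hF' hm'
      have := leaf_compare a m f O a' m' f' O₀ (leaf_orth hT hF hm) (leaf_orth hT' hF' hm')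
        (by linarith [l1.1, k1.2]) (by linarith [l2.1, k2.2]) (by linarith [l3.1, k3.2])
      linarith
    unfold Phi at *
    linarith
  unfold Phi at main
  have d1 : density A B C D 1 1 1 1 = WW A B C D X / WW A B C D Set.univ := by
    simp [density, tetra, WW, hX, XX]
  have d2 : density A₀ B₀ C₀ D₀ 1 1 1 1 = WW A₀ B₀ C₀ D₀ X₀ / WW A₀ B₀ C₀ D₀ Set.univ := by
    simp [density, tetra, WW, hX₀, XX]
  have pos : ∀ a b c d : E3, AffineIndependent ℝ ![a, b, c, d] → 0 < WW a b c d Set.univ := by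
    intro a b c d hi
    rw [WW_eq]
    unfold VV
    rw [Set.inter_univ]
    have htop : affineSpan ℝ (Set.range ![a, b, c, d]) = ⊤ := by
      rw [hi.affineSpan_eq_top_iff_card_eq_finrank_add_one]; simp
    apply ENNReal.toReal_pos
    · exact (Measure.measure_pos_of_nonempty_interior _
        (interior_convexHull_nonempty_iff_affineSpan_eq_top.2 htop)).ne'
    · exact ((Set.finite_range _).isCompact_convexHull ℝ).measure_lt_top.ne
  rw [d1, d2, div_le_div_iff₀ (pos _ _ _ _ haff) (pos _ _ _ _ haff₀)]
  linarith
end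

section
/- Let ε := 1/46. Every weighted tetrahedron T with all four radii equal to 1 and all six edge lengths in the interval [2, 2 + ε] satisfies δ(T) ≤ δ(T₀), where T₀ is any weighted tetrahedron with all radii 1 and all six edge lengths equal to 2 (the tight regular tetrahedron). -/
open MeasureTheory Metric

open scoped Pointwise

/-- The ambient Euclidean space. -/
abbrev E3 := EuclideanSpace ℝ (Fin 3)

/-- The positive orthant. -/
def orth : Set E3 := {x | ∀ i, 0 ≤ x i}

/-- The standard simplex cut out of the orthant. -/
def simp3 : Set E3 := {x | x ∈ orth ∧ x 0 + x 1 + x 2 ≤ 1}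

/-- The squared length form, written with squared edge lengths. -/
def Qf (a b c p q r : ℝ) (x : E3) : ℝ :=
  (x 0 + x 1 + x 2) * (a * x 0 + b * x 1 + c * x 2)
    - p * (x 0 * x 1) - q * (x 0 * x 2) - r * (x 1 * x 2)

lemma Qf_cont (a b c p q r : ℝ) : Continuous (Qf a b c p q r) := by
  unfold Qf; fun_prop

lemma Qf_smul (a b c p q r t : ℝ) (x : E3) : Qf a b c p q r (t • x) = t ^ 2 * Qf a b c p q r x := by
  simp [Qf]; ring

lemma orth_closed : IsClosed orth := by
  have : orth = ⋂ i : Fin 3, {x : E3 | 0 ≤ x i} := by ext; simp [orth]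
  rw [this]
  exact isClosed_iInter fun i => isClosed_le continuous_const (by fun_prop)

lemma orth_meas : MeasurableSet orth := orth_closed.measurableSet

lemma orth_smul {t : ℝ} (ht : 0 < t) (x : E3) : t • x ∈ orth ↔ x ∈ orth := by
  simp [orth, ht]

lemma smul_orth {t : ℝ} (ht : 0 < t) : t • orth = orth := by
  ext x
  rw [Set.mem_smul_set_iff_inv_smul_mem₀ ht.ne', orth_smul (inv_pos.2 ht)]

lemma layer : ∃ C : ENNReal, ∀ a b c p q r : ℝ, (∀ x ∈ orth, 0 ≤ Qf a b c p q r x) →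
    ∫⁻ x in orth, ENNReal.ofReal (Real.exp (-Qf a b c p q r x)) =
      C * volume (orth ∩ {x | Qf a b c p q r x < 1}) := by
  refine ⟨∫⁻ t in Set.Ioi (0:ℝ), ENNReal.ofReal (Real.sqrt (-Real.log t) ^ 3), ?_⟩
  intro a b c p q r hQ
  have hc := Qf_cont a b c p q r
  rw [lintegral_eq_lintegral_meas_lt _ (Filter.Eventually.of_forall fun x => (Real.exp_pos _).le)
    (by fun_prop), ← lintegral_mul_const _ (by fun_prop)]
  refine setLIntegral_congr_fun measurableSet_Ioi ?_
  intro t ht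
  have ht : 0 < t := ht
  dsimp only
  rw [Measure.restrict_apply (measurableSet_lt measurable_const (by fun_prop))]
  have h1 : {x : E3 | t < Real.exp (-Qf a b c p q r x)} ∩ orth =
      orth ∩ {x | Qf a b c p q r x < -Real.log t} := by
    ext x
    simp only [Set.mem_inter_iff, Set.mem_ofPred_eq]
    rw [← Real.log_lt_iff_lt_exp ht, and_comm, lt_neg]
  rw [h1]
  by_cases hl : 0 < -Real.log t
  · have hs := Real.sqrt_pos.2 hl
    have h2 : orth ∩ {x | Qf a b c p q r x < -Real.log t} =
        Real.sqrt (-Real.log t) • (orth ∩ {x | Qf a b c p q r x < 1}) := by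
      ext x
      rw [Set.mem_smul_set_iff_inv_smul_mem₀ hs.ne']
      simp only [Set.mem_inter_iff, Set.mem_ofPred_eq, orth_smul (inv_pos.2 hs), Qf_smul, inv_pow,
        Real.sq_sqrt hl.le]
      rw [inv_mul_lt_iff₀ hl, mul_one]
    rw [h2, Measure.addHaar_smul]
    simp [abs_of_nonneg hs.le]
  · have : orth ∩ {x | Qf a b c p q r x < -Real.log t} = ∅ := by
      ext x
      simp only [Set.mem_inter_iff, Set.mem_ofPred_eq, Set.mem_empty_iff_false, iff_false, not_and]
      intro hx h
      linarith [hQ x hx]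
    rw [this, Real.sqrt_eq_zero_of_nonpos (not_lt.1 hl)]
    simp

lemma gauss_int : Integrable (fun x : E3 => Real.exp (-‖x‖ ^ 2)) := by
  have := (GaussianFourier.integrable_cexp_neg_mul_sq_norm_add (V := E3) (b := 1) (by simp) 0 0).norm
  refine this.congr (Filter.Eventually.of_forall fun x => ?_)
  simp [Complex.norm_exp, ← Complex.ofReal_pow]

lemma norm_sq3 (x : E3) : ‖x‖ ^ 2 = x 0 ^ 2 + x 1 ^ 2 + x 2 ^ 2 := by
  rw [EuclideanSpace.norm_sq_eq, Fin.sum_univ_three]; simp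

/-- Standing bounds on the squared edge lengths. -/
def Good (a b c p q r : ℝ) : Prop :=
  (4 ≤ a ∧ a ≤ 4.1) ∧ (4 ≤ b ∧ b ≤ 4.1) ∧ (4 ≤ c ∧ c ≤ 4.1) ∧
  (4 ≤ p ∧ p ≤ 4.1) ∧ (4 ≤ q ∧ q ≤ 4.1) ∧ (4 ≤ r ∧ r ≤ 4.1)

lemma good4 : Good 4 4 4 4 4 4 := by norm_num [Good]

lemma Qf_bounds {a b c p q r : ℝ} (h : Good a b c p q r) {x : E3} (hx : x ∈ orth) :
    Qf a b c p q r x ≤ (21/20)^2 * Qf 4 4 4 4 4 4 x ∧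
    Qf 4 4 4 4 4 4 x ≤ (21/20)^2 * Qf a b c p q r x ∧
    2 * ‖x‖^2 ≤ Qf a b c p q r x ∧ (x 0 + x 1 + x 2)^2 ≤ Qf a b c p q r x := by
  obtain ⟨⟨h1, h1'⟩, ⟨h2, h2'⟩, ⟨h3, h3'⟩, ⟨h4, h4'⟩, ⟨h5, h5'⟩, ⟨h6, h6'⟩⟩ := h
  have x0 := hx 0
  have x1 := hx 1
  have x2 := hx 2
  rw [norm_sq3]
  unfold Qf
  generalize x 0 = u at *
  generalize x 1 = v at *
  generalize x 2 = w at *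
  have a0 := mul_nonneg x0 x0
  have a1 := mul_nonneg x1 x1
  have a2 := mul_nonneg x2 x2
  have b0 := mul_nonneg x0 x1
  have b1 := mul_nonneg x0 x2
  have b2 := mul_nonneg x1 x2
  have key : ∀ (y e : ℝ), 0 ≤ y → 4 ≤ e → e ≤ 4.1 → 4 * y ≤ e * y ∧ e * y ≤ 4.1 * y := by
    intro y e hy h h'
    exact ⟨by gcongr, by gcongr⟩
  have e1 := key _ a (add_nonneg (add_nonneg a0 b0) b1) h1 h1'
  have e2 := key _ b (add_nonneg (add_nonneg a1 b0) b2) h2 h2'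
  have e3 := key _ c (add_nonneg (add_nonneg a2 b1) b2) h3 h3'
  have e4 := key _ p b0 h4 h4'
  have e5 := key _ q b1 h5 h5'
  have e6 := key _ r b2 h6 h6'
  refine ⟨?_, ?_, ?_, ?_⟩ <;> norm_num at * <;> nlinarith

lemma Qf_pos {a b c p q r : ℝ} (h : Good a b c p q r) (x : E3) :
    ‖x‖^2 ≤ Qf a b c p q r x := by
  obtain ⟨⟨h1, h1'⟩, ⟨h2, h2'⟩, ⟨h3, h3'⟩, ⟨h4, h4'⟩, ⟨h5, h5'⟩, ⟨h6, h6'⟩⟩ := h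
  rw [norm_sq3]
  unfold Qf
  generalize x 0 = u at *
  generalize x 1 = v at *
  generalize x 2 = w at *
  have key : ∀ d y z : ℝ, -0.2 ≤ d → d ≤ 0.2 → -(0.1 * (y ^ 2 + z ^ 2)) ≤ d * (y * z) := by
    intro d y z h h'
    norm_num at *
    nlinarith [mul_nonneg (by linarith : 0 ≤ d + 1/5) (sq_nonneg (y + z)),
      mul_nonneg (by linarith : 0 ≤ 1/5 - d) (sq_nonneg (y - z))]
  have k1 := key (a + b - p - 4) u v (by norm_num at *; linarith) (by norm_num at *; linarith)
  have k2 := key (a + c - q - 4) u w (by norm_num at *; linarith) (by norm_num at *; linarith)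
  have k3 := key (b + c - r - 4) v w (by norm_num at *; linarith) (by norm_num at *; linarith)
  have m1 := mul_nonneg (sub_nonneg.2 h1) (sq_nonneg u)
  have m2 := mul_nonneg (sub_nonneg.2 h2) (sq_nonneg v)
  have m3 := mul_nonneg (sub_nonneg.2 h3) (sq_nonneg w)
  norm_num at *
  nlinarith [sq_nonneg (u + v + w), sq_nonneg u, sq_nonneg v, sq_nonneg w]

lemma int_exp {a b c p q r : ℝ} (h : Good a b c p q r) :
    IntegrableOn (fun x => Real.exp (-Qf a b c p q r x)) orth := by
  have hc := Qf_cont a b c p q r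
  refine Integrable.mono' (gauss_int.integrableOn (s := orth)) (by fun_prop) ?_
  refine (ae_restrict_iff' orth_meas).2 (Filter.Eventually.of_forall fun x hx => ?_)
  rw [Real.norm_of_nonneg (Real.exp_pos _).le, Real.exp_le_exp]
  nlinarith [(Qf_bounds h hx).2.2.1, sq_nonneg ‖x‖]

lemma int_mul {a b c p q r : ℝ} (h : Good a b c p q r) (i j : Fin 3) :
    IntegrableOn (fun x => x i * x j * Real.exp (-Qf a b c p q r x)) orth := by
  have hc := Qf_cont a b c p q r
  refine Integrable.mono' (gauss_int.integrableOn (s := orth)) (by fun_prop) ?_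
  refine (ae_restrict_iff' orth_meas).2 (Filter.Eventually.of_forall fun x hx => ?_)
  have hn : 0 ≤ x i * x j := mul_nonneg (hx i) (hx j)
  rw [Real.norm_of_nonneg (mul_nonneg hn (Real.exp_pos _).le)]
  have h1 : x i * x j ≤ Real.exp (x i * x j) := by
    linarith [Real.add_one_le_exp (x i * x j)]
  have h2 : x i * x j ≤ ‖x‖ ^ 2 := by
    have hi := PiLp.norm_apply_le x i
    have hj := PiLp.norm_apply_le x j
    rw [Real.norm_of_nonneg (hx _)] at hi hj
    rw [sq]
    exact mul_le_mul hi hj (hx j) (norm_nonneg _)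
  calc _ ≤ Real.exp (x i * x j) * Real.exp (-Qf a b c p q r x) := by gcongr
    _ = Real.exp (x i * x j - Qf a b c p q r x) := by rw [← Real.exp_add]; rfl
    _ ≤ _ := by
      rw [Real.exp_le_exp]
      linarith [(Qf_bounds h hx).2.2.1]

/-- The mixed second moment of the regular form. -/
noncomputable def Mom (i j : Fin 3) : ℝ := ∫ x in orth, x i * x j * Real.exp (-Qf 4 4 4 4 4 4 x)

lemma Mom_perm (e : Equiv.Perm (Fin 3)) (i j : Fin 3)
    (hQ : ∀ x : E3, Qf 4 4 4 4 4 4 (LinearIsometryEquiv.piLpCongrLeft 2 ℝ ℝ e x)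
      = Qf 4 4 4 4 4 4 x) : Mom (e i) (e j) = Mom i j := by
  unfold Mom
  set L := LinearIsometryEquiv.piLpCongrLeft 2 ℝ ℝ e
  have hL : ∀ x i, L x (e i) = x i := by
    intro x i
    simp [L, LinearIsometryEquiv.piLpCongrLeft_apply, Equiv.piCongrLeft']
  rw [← L.measurePreserving.setIntegral_preimage_emb L.toHomeomorph.measurableEmbedding]
  have : L ⁻¹' orth = orth := by
    ext x
    simp only [orth, Set.mem_preimage, Set.mem_ofPred_eq]
    rw [← e.forall_congr_right]
    simp only [hL]
  rw [this]
  simp only [hL, hQ]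

lemma Mom_eq : Mom 0 2 = Mom 0 1 ∧ Mom 1 2 = Mom 0 1 := by
  constructor
  · have := Mom_perm (Equiv.swap 1 2) 0 1 ?_
    · rw [← this]; congr 1
    intro x
    simp [Qf, LinearIsometryEquiv.piLpCongrLeft_apply, Equiv.piCongrLeft', Equiv.swap_apply_def]
    ring
  · have := Mom_perm (Equiv.swap 0 2) 0 1 ?_
    · rw [← this]; unfold Mom; congr 1; ext x; 
      simp [Equiv.swap_apply_def]; ring
    intro x
    simp [Qf, LinearIsometryEquiv.piLpCongrLeft_apply, Equiv.piCongrLeft', Equiv.swap_apply_def]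
    ring

lemma scale {a b c p q r : ℝ} (i j : Fin 3) :
    ∫ x in orth, x i * x j * Real.exp (-((21/20)^2 * Qf a b c p q r x)) =
     (20/21)^5 * ∫ x in orth, x i * x j * Real.exp (-Qf a b c p q r x) := by
  have := Measure.setIntegral_comp_smul_of_pos volume
    (fun x : E3 => x i * x j * Real.exp (-Qf a b c p q r x)) orth (R := 21/20) (by norm_num)
  rw [smul_orth (by norm_num)] at this
  simp only [Qf_smul, PiLp.smul_apply, smul_eq_mul, finrank_euclideanSpace, Fintype.card_fin] at this
  have h2 : ∀ x : E3, 21/20 * x i * (21/20 * x j) * Real.exp (-((21/20)^2 * Qf a b c p q r x)) =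
    (21/20)^2 * (x i * x j * Real.exp (-((21/20)^2 * Qf a b c p q r x))) := fun x => by ring
  simp only [h2, integral_const_mul] at this
  norm_num at this ⊢
  linarith

lemma mom_lower {a b c p q r : ℝ} (h : Good a b c p q r) (i j : Fin 3) :
    (20/21)^5 * Mom i j ≤ ∫ x in orth, x i * x j * Real.exp (-Qf a b c p q r x) := by
  unfold Mom
  rw [← scale]
  refine integral_mono_of_nonneg ?_ (int_mul h i j) ?_
  · refine (ae_restrict_iff' orth_meas).2 (Filter.Eventually.of_forall fun x hx => ?_)
    exact mul_nonneg (mul_nonneg (hx i) (hx j)) (Real.exp_pos _).le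
  · refine (ae_restrict_iff' orth_meas).2 (Filter.Eventually.of_forall fun x hx => ?_)
    refine mul_le_mul_of_nonneg_left ?_ (mul_nonneg (hx i) (hx j))
    exact Real.exp_le_exp.2 (neg_le_neg (Qf_bounds h hx).1)

lemma mom_upper {a b c p q r : ℝ} (h : Good a b c p q r) (i j : Fin 3) :
    (20/21)^5 * (∫ x in orth, x i * x j * Real.exp (-Qf a b c p q r x)) ≤ Mom i j := by
  unfold Mom
  rw [← scale]
  refine integral_mono_of_nonneg ?_ (int_mul good4 i j) ?_
  · refine (ae_restrict_iff' orth_meas).2 (Filter.Eventually.of_forall fun x hx => ?_)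
    exact mul_nonneg (mul_nonneg (hx i) (hx j)) (Real.exp_pos _).le
  · refine (ae_restrict_iff' orth_meas).2 (Filter.Eventually.of_forall fun x hx => ?_)
    refine mul_le_mul_of_nonneg_left ?_ (mul_nonneg (hx i) (hx j))
    exact Real.exp_le_exp.2 (neg_le_neg (Qf_bounds h hx).2.1)

lemma Mom_nonneg (i j : Fin 3) : 0 ≤ Mom i j :=
  setIntegral_nonneg orth_meas fun _ hx =>
    mul_nonneg (mul_nonneg (hx i) (hx j)) (Real.exp_pos _).le

lemma int4 {μ : Measure E3} {f g h k : E3 → ℝ} (hf : Integrable f μ) (hg : Integrable g μ)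
    (hh : Integrable h μ) (hk : Integrable k μ) {s t u : ℝ} :
    ∫ x, (f x + (s * g x + t * h x + u * k x)) ∂μ =
      (∫ x, f x ∂μ) + (s * (∫ x, g x ∂μ) + t * (∫ x, h x ∂μ) + u * (∫ x, k x ∂μ)) := by
  have a1 : Integrable (fun x => s * g x) μ := hg.const_mul s
  have a2 : Integrable (fun x => t * h x) μ := hh.const_mul t
  have a3 : Integrable (fun x => u * k x) μ := hk.const_mul u
  have a4 : Integrable (fun x => s * g x + t * h x) μ := a1.add a2
  have a5 : Integrable (fun x => s * g x + t * h x + u * k x) μ := a4.add a3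
  rw [integral_add hf a5, integral_add a4 a3, integral_add a1 a2]
  simp only [integral_const_mul]

lemma vertex {a b c p q r : ℝ} (h : Good a b c p q r) :
    ∫ x in orth, Real.exp (-Qf a b c p q r x) ≤
     (∫ x in orth, Real.exp (-Qf 4 4 4 4 4 4 x))
      - ((a - 4) + (b - 4) + (c - 4)) * (2 * (20/21)^5 * Mom 0 1)
      + ((p - 4) + (q - 4) + (r - 4)) * ((21/20)^5 * Mom 0 1) := by
  obtain ⟨m2, m3⟩ := Mom_eq
  have l01 := mom_lower h 0 1
  have l02 := mom_lower h 0 2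
  have l12 := mom_lower h 1 2
  have u01 := mom_upper h 0 1
  have u02 := mom_upper h 0 2
  have u12 := mom_upper h 1 2
  rw [m2] at l02 u02
  rw [m3] at l12 u12
  have i01 := int_mul h 0 1
  have i02 := int_mul h 0 2
  have i12 := int_mul h 1 2
  have n0 := int_exp good4
  have n1 := int_exp h
  have hg := h
  obtain ⟨⟨h1, h1'⟩, ⟨h2, h2'⟩, ⟨h3, h3'⟩, ⟨h4, h4'⟩, ⟨h5, h5'⟩, ⟨h6, h6'⟩⟩ := h
  have key : ∫ x in orth, (Real.exp (-Qf a b c p q r x)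
      + (((a-4)+(b-4)-(p-4)) * (x 0 * x 1 * Real.exp (-Qf a b c p q r x))
      + ((a-4)+(c-4)-(q-4)) * (x 0 * x 2 * Real.exp (-Qf a b c p q r x))
      + ((b-4)+(c-4)-(r-4)) * (x 1 * x 2 * Real.exp (-Qf a b c p q r x)))) ≤
      ∫ x in orth, Real.exp (-Qf 4 4 4 4 4 4 x) := by
    refine setIntegral_mono_on ?_ n0 orth_meas ?_
    · exact n1.add (((i01.const_mul _).add (i02.const_mul _)).add (i12.const_mul _))
    · intro x hx
      have hh : Qf a b c p q r x - Qf 4 4 4 4 4 4 x ≥ ((a-4)+(b-4)-(p-4)) * (x 0 * x 1)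
         + ((a-4)+(c-4)-(q-4)) * (x 0 * x 2) + ((b-4)+(c-4)-(r-4)) * (x 1 * x 2) := by
        unfold Qf
        nlinarith [mul_nonneg (sub_nonneg.2 h1) (sq_nonneg (x 0)),
          mul_nonneg (sub_nonneg.2 h2) (sq_nonneg (x 1)),
          mul_nonneg (sub_nonneg.2 h3) (sq_nonneg (x 2))]
      have e1 : Real.exp (-Qf 4 4 4 4 4 4 x) = Real.exp (-Qf a b c p q r x) *
          Real.exp (Qf a b c p q r x - Qf 4 4 4 4 4 4 x) := by
        rw [← Real.exp_add]; congr 1; ring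
      rw [e1]
      have e2 := Real.add_one_le_exp (Qf a b c p q r x - Qf 4 4 4 4 4 4 x)
      calc _ = Real.exp (-Qf a b c p q r x) * ((((a-4)+(b-4)-(p-4)) * (x 0 * x 1)
         + ((a-4)+(c-4)-(q-4)) * (x 0 * x 2) + ((b-4)+(c-4)-(r-4)) * (x 1 * x 2)) + 1) := by ring
        _ ≤ _ := by
          refine mul_le_mul_of_nonneg_left ?_ (Real.exp_pos _).le
          linarith
  rw [int4 n1 i01 i02 i12] at key
  generalize (∫ x in orth, x 0 * x 1 * Real.exp (-Qf a b c p q r x)) = I01 at *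
  generalize (∫ x in orth, x 0 * x 2 * Real.exp (-Qf a b c p q r x)) = I02 at *
  generalize (∫ x in orth, x 1 * x 2 * Real.exp (-Qf a b c p q r x)) = I12 at *
  have v01 : I01 ≤ (21/20)^5 * Mom 0 1 := by norm_num at *; linarith
  have v02 : I02 ≤ (21/20)^5 * Mom 0 1 := by norm_num at *; linarith
  have v12 : I12 ≤ (21/20)^5 * Mom 0 1 := by norm_num at *; linarith
  have t1 := mul_le_mul_of_nonneg_left (add_le_add l01 l02) (sub_nonneg.2 h1)
  have t2 := mul_le_mul_of_nonneg_left (add_le_add l01 l12) (sub_nonneg.2 h2)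
  have t3 := mul_le_mul_of_nonneg_left (add_le_add l02 l12) (sub_nonneg.2 h3)
  have t4 := mul_le_mul_of_nonneg_left v01 (sub_nonneg.2 h4)
  have t5 := mul_le_mul_of_nonneg_left v02 (sub_nonneg.2 h5)
  have t6 := mul_le_mul_of_nonneg_left v12 (sub_nonneg.2 h6)
  linarith

/-- Volume of the sector in simplex coordinates. -/
noncomputable def sec (a b c p q r : ℝ) : ℝ :=
  (volume (orth ∩ {x | Qf a b c p q r x < 1})).toReal

lemma sec_sum {a b c p q r : ℝ} (h : Good a b c p q r) :
    sec a b c p q r + sec a p q b c r + sec b p r a c q + sec c q r a b p ≤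
      4 * sec 4 4 4 4 4 4 := by
  obtain ⟨C, hC⟩ := layer
  have key : ∀ a b c p q r, Good a b c p q r →
      ∫ x in orth, Real.exp (-Qf a b c p q r x) = C.toReal * sec a b c p q r := by
    intro a b c p q r h
    rw [integral_eq_lintegral_of_nonneg_ae (Filter.Eventually.of_forall fun x => (Real.exp_pos _).le)
      (int_exp h).aestronglyMeasurable, hC, ENNReal.toReal_mul]
    · rfl
    intro x hx
    nlinarith [(Qf_bounds h hx).2.2.1, sq_nonneg ‖x‖]
  have hg := h
  obtain ⟨h1, h2, h3, h4, h5, h6⟩ := h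
  have g2 : Good a p q b c r := ⟨h1, h4, h5, h2, h3, h6⟩
  have g3 : Good b p r a c q := ⟨h2, h4, h6, h1, h3, h5⟩
  have g4 : Good c q r a b p := ⟨h3, h5, h6, h1, h2, h4⟩
  have v1 := vertex hg
  have v2 := vertex g2
  have v3 := vertex g3
  have v4 := vertex g4
  rw [key _ _ _ _ _ _ hg, key _ _ _ _ _ _ good4] at v1
  rw [key _ _ _ _ _ _ g2, key _ _ _ _ _ _ good4] at v2
  rw [key _ _ _ _ _ _ g3, key _ _ _ _ _ _ good4] at v3
  rw [key _ _ _ _ _ _ g4, key _ _ _ _ _ _ good4] at v4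
  have hCpos : 0 < C.toReal := by
    have h0 := key _ _ _ _ _ _ good4
    have : 0 < ∫ x in orth, Real.exp (-Qf 4 4 4 4 4 4 x) := by
      rw [integral_pos_iff_support_of_nonneg (fun x => (Real.exp_pos _).le) (int_exp good4)]
      have : Function.support (fun x : E3 => Real.exp (-Qf 4 4 4 4 4 4 x)) = Set.univ := by
        ext x; simp [(Real.exp_pos _).ne']
      rw [this, Measure.restrict_apply_univ]
      have ho : IsOpen {x : E3 | ∀ i, 0 < x i} := by
        have : {x : E3 | ∀ i, 0 < x i} = ⋂ i : Fin 3, {x : E3 | 0 < x i} := by ext; simp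
        rw [this]
        exact isOpen_iInter_of_finite fun i => isOpen_lt continuous_const (by fun_prop)
      refine lt_of_lt_of_le (ho.measure_pos volume ⟨WithLp.toLp 2 (fun _ => 1), by simp⟩) ?_
      exact measure_mono fun x hx i => (hx i).le
    rw [h0] at this
    rcases (ENNReal.toReal_nonneg (a := C)).lt_or_eq with h | h
    · exact h
    · rw [← h] at this; simp at this
  have hM := Mom_nonneg 0 1
  have hS : 0 ≤ ((a-4)+(b-4)+(c-4)+(p-4)+(q-4)+(r-4)) * Mom 0 1 :=
    mul_nonneg (by linarith [h1.1, h2.1, h3.1, h4.1, h5.1, h6.1]) hM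
  refine le_of_mul_le_mul_left ?_ hCpos
  norm_num at v1 v2 v3 v4 ⊢
  nlinarith

/-- The linear map sending the coordinate vectors to three given vectors. -/
noncomputable def Lm (u v w : E3) : E3 →ₗ[ℝ] E3 where
  toFun x := x 0 • u + x 1 • v + x 2 • w
  map_add' x y := by simp only [PiLp.add_apply]; module
  map_smul' t x := by simp only [PiLp.smul_apply, smul_eq_mul, RingHom.id_apply]; module

lemma Lm_apply (u v w x : E3) : Lm u v w x = x 0 • u + x 1 • v + x 2 • w := rfl

lemma inner_sub_sub (A B C : E3) :
    inner ℝ (B - A) (C - A) = (dist A B ^ 2 + dist A C ^ 2 - dist B C ^ 2) / 2 := by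
  have h : B - C = (B - A) - (C - A) := by abel
  rw [dist_comm A B, dist_comm A C, dist_eq_norm B A, dist_eq_norm C A, dist_eq_norm B C, h]
  generalize B - A = u
  generalize C - A = v
  rw [@norm_sub_sq ℝ]
  simp only [RCLike.re_to_real]
  ring

lemma Lm_norm (A B C D x : E3) : ‖Lm (B - A) (C - A) (D - A) x‖ ^ 2 =
    Qf (dist A B ^ 2) (dist A C ^ 2) (dist A D ^ 2) (dist B C ^ 2) (dist B D ^ 2)
      (dist C D ^ 2) x := by
  rw [Lm_apply, ← real_inner_self_eq_norm_sq]
  simp only [inner_add_left, inner_add_right, real_inner_smul_left, real_inner_smul_right]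
  simp only [inner_sub_sub, dist_self, dist_comm C B, dist_comm D B, dist_comm D C]
  unfold Qf
  ring

lemma tetra_eq (A B C D : E3) :
    tetra A B C D = (fun y => A + y) '' (Lm (B - A) (C - A) (D - A) '' simp3) := by
  apply Set.Subset.antisymm
  · refine convexHull_min ?_ ?_
    · intro z hz
      simp only [Set.mem_insert_iff, Set.mem_singleton_iff] at hz
      have mk : ∀ a b c : ℝ, 0 ≤ a → 0 ≤ b → 0 ≤ c → a + b + c ≤ 1 →
          A + (a • (B - A) + b • (C - A) + c • (D - A)) ∈
          (fun y => A + y) '' (Lm (B - A) (C - A) (D - A) '' simp3) := by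
        intro a b c ha hb hc h
        refine ⟨_, ⟨WithLp.toLp 2 ![a, b, c], ⟨?_, ?_⟩, rfl⟩, ?_⟩
        · intro i; fin_cases i <;> simpa
        · simpa using h
        · simp [Lm_apply]
      rcases hz with rfl | rfl | rfl | rfl
      · simpa using mk 0 0 0 (by norm_num) (by norm_num) (by norm_num) (by norm_num)
      · simpa using mk 1 0 0 (by norm_num) (by norm_num) (by norm_num) (by norm_num)
      · simpa using mk 0 1 0 (by norm_num) (by norm_num) (by norm_num) (by norm_num)
      · simpa using mk 0 0 1 (by norm_num) (by norm_num) (by norm_num) (by norm_num)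
    · have hs : Convex ℝ simp3 := by
        intro x hx y hy a b ha hb hab
        refine ⟨fun i => ?_, ?_⟩
        · have := mul_nonneg ha (hx.1 i)
          have := mul_nonneg hb (hy.1 i)
          simp; linarith
        · have := mul_le_mul_of_nonneg_left hx.2 ha
          have := mul_le_mul_of_nonneg_left hy.2 hb
          simp; linarith
      exact (hs.linear_image _).translate A
  · rintro _ ⟨_, ⟨x, hx, rfl⟩, rfl⟩
    have hA : A ∈ tetra A B C D := subset_convexHull _ _ (by simp)
    have hB : B ∈ tetra A B C D := subset_convexHull _ _ (by simp)
    have hC : C ∈ tetra A B C D := subset_convexHull _ _ (by simp)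
    have hD : D ∈ tetra A B C D := subset_convexHull _ _ (by simp)
    have hc : Convex ℝ (tetra A B C D) := convex_convexHull _ _
    have := hc.sum_mem (t := Finset.univ) (w := ![1 - x 0 - x 1 - x 2, x 0, x 1, x 2])
      (z := ![A, B, C, D]) ?_ ?_ ?_
    · simp only [Fin.sum_univ_four] at this
      simp only [Lm_apply]
      convert this using 1
      simp
      module
    · have h2 := hx.2
      intro i _
      fin_cases i
      · simp; linarith
      · exact hx.1 0
      · exact hx.1 1
      · exact hx.1 2
    · simp [Fin.sum_univ_four]; ring
    · intro i _
      fin_cases i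
      · exact hA
      · exact hB
      · exact hC
      · exact hD

/-- Goodness of a tetrahedron, in terms of its squared edge lengths. -/
def GoodT (A B C D : E3) : Prop :=
  Good (dist A B ^ 2) (dist A C ^ 2) (dist A D ^ 2) (dist B C ^ 2) (dist B D ^ 2) (dist C D ^ 2)

/-- Sector volume in terms of the vertices. -/
noncomputable def secT (A B C D : E3) : ℝ :=
  sec (dist A B ^ 2) (dist A C ^ 2) (dist A D ^ 2) (dist B C ^ 2) (dist B D ^ 2) (dist C D ^ 2)

lemma geo (A B C D : E3) (h : GoodT A B C D) : ∃ k : ℝ, 0 < k ∧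
    (volume (tetra A B C D)).toReal = k * (volume simp3).toReal ∧
    (volume (tetra A B C D ∩ ball A 1)).toReal = k * secT A B C D ∧
    (volume (tetra A B C D ∩ closedBall A 1)).toReal = k * secT A B C D := by
  set L := Lm (B - A) (C - A) (D - A) with hL
  have hdet : LinearMap.det L ≠ 0 := by
    rw [← isUnit_iff_ne_zero, ← LinearMap.isUnit_iff_isUnit_det, LinearMap.isUnit_iff_ker_eq_bot,
      LinearMap.ker_eq_bot']
    intro x hx
    have hn := Lm_norm A B C D x
    rw [← hL, hx] at hn
    have hp := Qf_pos h x
    rw [norm_zero] at hn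
    have : ‖x‖ ^ 2 ≤ 0 := by linarith
    exact norm_eq_zero.1 (pow_eq_zero_iff two_ne_zero |>.1 (le_antisymm this (sq_nonneg _)))
  have him : ∀ S : Set E3, (volume ((fun y => A + y) '' (L '' S))).toReal =
      |LinearMap.det L| * (volume S).toReal := by
    intro S
    rw [Set.image_add_left, measure_preimage_add, Measure.addHaar_image_linearMap,
      ENNReal.toReal_mul, ENNReal.toReal_ofReal (abs_nonneg _)]
  have hball : tetra A B C D ∩ ball A 1 = (fun y => A + y) '' (L '' (orth ∩
      {x | Qf (dist A B ^ 2) (dist A C ^ 2) (dist A D ^ 2) (dist B C ^ 2) (dist B D ^ 2)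
      (dist C D ^ 2) x < 1})) := by
    rw [tetra_eq]
    have hmem : ∀ x, A + L x ∈ ball A 1 ↔ Qf (dist A B ^ 2) (dist A C ^ 2) (dist A D ^ 2)
        (dist B C ^ 2) (dist B D ^ 2) (dist C D ^ 2) x < 1 := by
      intro x
      rw [← Lm_norm, mem_ball, dist_eq_norm, add_sub_cancel_left, sq_lt_one_iff₀ (norm_nonneg _)]
    ext z
    constructor
    · rintro ⟨⟨_, ⟨x, hx, rfl⟩, rfl⟩, hz⟩
      exact ⟨_, ⟨x, ⟨hx.1, (hmem x).1 hz⟩, rfl⟩, rfl⟩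
    · rintro ⟨_, ⟨x, hx, rfl⟩, rfl⟩
      refine ⟨⟨_, ⟨x, ⟨hx.1, ?_⟩, rfl⟩, rfl⟩, (hmem x).2 hx.2⟩
      have h1 := (Qf_bounds h hx.1).2.2.2
      have h2 : _ < (1:ℝ) := hx.2
      nlinarith
  have hb : (volume (tetra A B C D ∩ ball A 1)).toReal = |LinearMap.det L| * secT A B C D := by
    rw [hball, him]; rfl
  refine ⟨|LinearMap.det L|, abs_pos.2 hdet, by rw [tetra_eq, him], hb, ?_⟩
  rw [← hb]
  congr 1
  refine measure_congr ?_
  refine Filter.EventuallyEq.inter (Filter.EventuallyEq.refl _ _) ?_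
  rw [← ball_union_sphere]
  exact union_ae_eq_left_of_ae_eq_empty (ae_eq_empty.2 (Measure.addHaar_sphere volume A 1))

lemma tetra_B (A B C D : E3) : tetra A B C D = tetra B A C D := by
  unfold tetra; congr 1; ext; simp; tauto

lemma tetra_C (A B C D : E3) : tetra A B C D = tetra C A B D := by
  unfold tetra; congr 1; ext; simp; tauto

lemma tetra_D (A B C D : E3) : tetra A B C D = tetra D A B C := by
  unfold tetra; congr 1; ext; simp; tauto

lemma tetra_meas (A B C D : E3) : MeasurableSet (tetra A B C D) := by
  have : IsCompact (tetra A B C D) := Set.Finite.isCompact_convexHull ℝ (Set.toFinite _)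
  exact this.measurableSet

lemma goodT_perm {A B C D : E3} (h : GoodT A B C D) :
    GoodT B A C D ∧ GoodT C A B D ∧ GoodT D A B C := by
  obtain ⟨h1, h2, h3, h4, h5, h6⟩ := h
  unfold GoodT
  rw [dist_comm B A, dist_comm C A, dist_comm C B, dist_comm D A, dist_comm D B, dist_comm D C]
  exact ⟨⟨h1, h4, h5, h2, h3, h6⟩, ⟨h2, h4, h6, h1, h3, h5⟩, ⟨h3, h5, h6, h1, h2, h4⟩⟩

lemma density_upper {A B C D : E3} (h : GoodT A B C D) :
    density A B C D 1 1 1 1 ≤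
      (secT A B C D + secT B A C D + secT C A B D + secT D A B C) / (volume simp3).toReal := by
  obtain ⟨gB, gC, gD⟩ := goodT_perm h
  obtain ⟨k1, p1, v1, -, s1⟩ := geo A B C D h
  obtain ⟨k2, p2, v2, -, s2⟩ := geo B A C D gB
  obtain ⟨k3, p3, v3, -, s3⟩ := geo C A B D gC
  obtain ⟨k4, p4, v4, -, s4⟩ := geo D A B C gD
  rw [← tetra_B] at v2 s2
  rw [← tetra_C] at v3 s3
  rw [← tetra_D] at v4 s4
  unfold density
  set T := tetra A B C D
  have hle : (volume (T ∩ (closedBall A 1 ∪ closedBall B 1 ∪ closedBall C 1 ∪ closedBall D 1))).toReal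
      ≤ k1 * secT A B C D + k2 * secT B A C D + k3 * secT C A B D + k4 * secT D A B C := by
    rw [← s1, ← s2, ← s3, ← s4, Set.inter_union_distrib_left, Set.inter_union_distrib_left,
      Set.inter_union_distrib_left]
    have e := fun S S' : Set E3 => measureReal_union_le (μ := volume) S S'
    simp only [Measure.real] at e
    refine (e _ _).trans (add_le_add ((e _ _).trans (add_le_add (e _ _) le_rfl)) le_rfl)
  refine (div_le_div_of_nonneg_right hle ENNReal.toReal_nonneg).trans (le_of_eq ?_)
  have c : ∀ k s : ℝ, 0 < k → (volume T).toReal = k * (volume simp3).toReal →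
      k * s / (volume T).toReal = s / (volume simp3).toReal := by
    intro k s hk hv
    rw [hv, mul_div_mul_left _ _ hk.ne']
  rw [add_div, add_div, add_div, c _ _ p1 v1, c _ _ p2 v2, c _ _ p3 v3, c _ _ p4 v4, add_div,
    add_div, add_div]

lemma density_lower {A B C D : E3} (h : GoodT A B C D) :
    (secT A B C D + secT B A C D + secT C A B D + secT D A B C) / (volume simp3).toReal ≤
    density A B C D 1 1 1 1 := by
  obtain ⟨gB, gC, gD⟩ := goodT_perm h
  obtain ⟨k1, p1, v1, s1, -⟩ := geo A B C D h
  obtain ⟨k2, p2, v2, s2, -⟩ := geo B A C D gB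
  obtain ⟨k3, p3, v3, s3, -⟩ := geo C A B D gC
  obtain ⟨k4, p4, v4, s4, -⟩ := geo D A B C gD
  rw [← tetra_B] at v2 s2
  rw [← tetra_C] at v3 s3
  rw [← tetra_D] at v4 s4
  have hTm : MeasurableSet (tetra A B C D) := tetra_meas A B C D
  unfold density
  set T := tetra A B C D
  have dj : ∀ X Y : E3, 4 ≤ dist X Y ^ 2 → Disjoint (T ∩ ball X 1) (T ∩ ball Y 1) := by
    intro X Y hd
    refine Disjoint.mono Set.inter_subset_right Set.inter_subset_right (ball_disjoint_ball ?_)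
    nlinarith [dist_nonneg (x := X) (y := Y)]
  have hle : k1 * secT A B C D + k2 * secT B A C D + k3 * secT C A B D + k4 * secT D A B C ≤
     (volume (T ∩ (closedBall A 1 ∪ closedBall B 1 ∪ closedBall C 1 ∪ closedBall D 1))).toReal
      := by
    obtain ⟨⟨h1, -⟩, ⟨h2, -⟩, ⟨h3, -⟩, ⟨h4, -⟩, ⟨h5, -⟩, ⟨h6, -⟩⟩ := h
    have hf : ∀ X : E3, ∀ S : Set E3, volume (S ∩ closedBall X 1) ≠ ⊤ := fun X S =>
      ((measure_mono Set.inter_subset_right).trans_lt measure_closedBall_lt_top).ne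
    have hf' : ∀ X : E3, volume (T ∩ ball X 1) ≠ ⊤ := fun X =>
      ((measure_mono Set.inter_subset_right).trans_lt measure_ball_lt_top).ne
    have hm : ∀ X : E3, MeasurableSet (T ∩ ball X 1) := fun X => hTm.inter measurableSet_ball
    rw [← s1, ← s2, ← s3, ← s4, ← ENNReal.toReal_add (hf' _) (hf' _),
      ← measure_union (dj A B h1) (hm _),
      ← ENNReal.toReal_add (measure_union_ne_top (hf' _) (hf' _)) (hf' _),
      ← measure_union (Set.disjoint_union_left.2 ⟨dj A C h2, dj B C h4⟩) (hm _),
      ← ENNReal.toReal_add (measure_union_ne_top (measure_union_ne_top (hf' _) (hf' _)) (hf' _)) (hf' _),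
      ← measure_union (Set.disjoint_union_left.2 ⟨Set.disjoint_union_left.2
        ⟨dj A D h3, dj B D h5⟩, dj C D h6⟩) (hm _)]
    rw [Set.inter_union_distrib_left, Set.inter_union_distrib_left, Set.inter_union_distrib_left]
    refine ENNReal.toReal_mono (measure_union_ne_top (measure_union_ne_top
      (measure_union_ne_top (hf _ _) (hf _ _)) (hf _ _)) (hf _ _)) (measure_mono ?_)
    have i : ∀ X : E3, T ∩ ball X 1 ⊆ T ∩ closedBall X 1 := fun X =>
      Set.inter_subset_inter_right _ ball_subset_closedBall
    exact Set.union_subset_union (Set.union_subset_union (Set.union_subset_union (i _) (i _)) (i _))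
      (i _)
  refine (le_of_eq ?_).trans (div_le_div_of_nonneg_right hle ENNReal.toReal_nonneg)
  have c : ∀ k s : ℝ, 0 < k → (volume T).toReal = k * (volume simp3).toReal →
      k * s / (volume T).toReal = s / (volume simp3).toReal := by
    intro k s hk hv
    rw [hv, mul_div_mul_left _ _ hk.ne']
  rw [add_div, add_div, add_div, add_div, add_div, add_div, c _ _ p1 v1, c _ _ p2 v2,
    c _ _ p3 v3, c _ _ p4 v4]

/-- With ε = 1/46, every weighted tetrahedron with radii 1 and edges in [2, 2 + ε]
is at most as dense as the tight regular tetrahedron of type 1111. -/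
theorem local_1111
    (A B C D A₀ B₀ C₀ D₀ : EuclideanSpace ℝ (Fin 3))
    (haff : AffineIndependent ℝ ![A, B, C, D])
    (hAB : dist A B ∈ Set.Icc (2 : ℝ) (2 + 1 / 46))
    (hAC : dist A C ∈ Set.Icc (2 : ℝ) (2 + 1 / 46))
    (hAD : dist A D ∈ Set.Icc (2 : ℝ) (2 + 1 / 46))
    (hBC : dist B C ∈ Set.Icc (2 : ℝ) (2 + 1 / 46))
    (hBD : dist B D ∈ Set.Icc (2 : ℝ) (2 + 1 / 46))
    (hCD : dist C D ∈ Set.Icc (2 : ℝ) (2 + 1 / 46))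
    (haff₀ : AffineIndependent ℝ ![A₀, B₀, C₀, D₀])
    (hAB₀ : dist A₀ B₀ = 2) (hAC₀ : dist A₀ C₀ = 2) (hAD₀ : dist A₀ D₀ = 2)
    (hBC₀ : dist B₀ C₀ = 2) (hBD₀ : dist B₀ D₀ = 2) (hCD₀ : dist C₀ D₀ = 2) :
    density A B C D 1 1 1 1 ≤ density A₀ B₀ C₀ D₀ 1 1 1 1 := by
  have hsq : ∀ X Y : E3, dist X Y ∈ Set.Icc (2 : ℝ) (2 + 1 / 46) →
      4 ≤ dist X Y ^ 2 ∧ dist X Y ^ 2 ≤ 4.1 := by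
    rintro X Y ⟨h1, h2⟩
    norm_num at *
    constructor <;> nlinarith
  have hG : GoodT A B C D := ⟨hsq _ _ hAB, hsq _ _ hAC, hsq _ _ hAD, hsq _ _ hBC, hsq _ _ hBD,
    hsq _ _ hCD⟩
  have hG₀ : GoodT A₀ B₀ C₀ D₀ := by
    unfold GoodT
    rw [hAB₀, hAC₀, hAD₀, hBC₀, hBD₀, hCD₀]
    norm_num [Good]
  refine (density_upper hG).trans (le_trans ?_ (density_lower hG₀))
  refine div_le_div_of_nonneg_right ?_ ENNReal.toReal_nonneg
  have hs := sec_sum hG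
  unfold secT
  rw [dist_comm B A, dist_comm C A, dist_comm C B, dist_comm D A, dist_comm D B, dist_comm D C,
    dist_comm B₀ A₀, dist_comm C₀ A₀, dist_comm C₀ B₀, dist_comm D₀ A₀, dist_comm D₀ B₀,
    dist_comm D₀ C₀, hAB₀, hAC₀, hAD₀, hBC₀, hBD₀, hCD₀]
  norm_num at hs ⊢
  linarith
end
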